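/- arXiv:1502.05576 — 3 statements merged into one kernel-verified Lean document; each statement's English description precedes it below -/
import Mathlib

section
/- Let G : 𝔻 → ℂ be holomorphic generating a C₀-semigroup of composition operators via A : f ↦ G·f′. Suppose there is η > 0 with ess sup_{z∈𝕋} Re(z̄ G(z)) ≤ −η (boundary values by radial limits) and that Re G′ is bounded on 𝔻. Then A generates an immediately trace-class semigroup of composition operators on H²(𝔻) and on the Dirichlet space 𝒟. -/
open Complex MeasureTheory Filter Set Metric
open scoped Real Topology ENNReal

noncomputable section

/-- The weighted Hardy space `H²(β)`, modeled as the `ℓ²` space of weighted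
Taylor coefficient sequences: the function `f(z) = Σ cₙ zⁿ` corresponds to the
square-summable sequence `(cₙ βₙ)ₙ`. -/
abbrev WH2 : Type := lp (fun _ : ℕ => ℂ) 2

/-- The analytic function on the unit disc associated to an element of `H²(β)`. -/
def wToFun (β : ℕ → ℝ) (f : WH2) (z : ℂ) : ℂ := ∑' n : ℕ, (f n / (β n : ℂ)) * z ^ n

/-- The open unit disc. -/
def uDisc : Set ℂ := Metric.ball 0 1

/-- Weights of the classical Hardy space `H²(𝔻)` (`βₙ = 1`). -/
def hardyW : ℕ → ℝ := fun _ => 1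

/-- Weights of the Dirichlet space `𝒟` (`β₀ = 1`, `βₙ = √n`). -/
def dirichletW : ℕ → ℝ := fun n => if n = 0 then 1 else Real.sqrt n

/-- The monomial `eₙ(z) = zⁿ` as an element of `H²(β)`. -/
def eW (β : ℕ → ℝ) (n : ℕ) : WH2 := lp.single 2 n ((β n : ℝ) : ℂ)

/-- `T` acts as the composition operator with analytic self-map symbol `φ` on `H²(β)`. -/
def RepresentsComp (β : ℕ → ℝ) (T : WH2 →L[ℂ] WH2) (φ : ℂ → ℂ) : Prop :=
  DifferentiableOn ℂ φ uDisc ∧ MapsTo φ uDisc uDisc ∧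
  ∀ f : WH2, ∀ z ∈ uDisc, wToFun β (T f) z = wToFun β f (φ z)

/-- `T` is a composition operator on `H²(β)`. -/
def IsCompositionOperator (β : ℕ → ℝ) (T : WH2 →L[ℂ] WH2) : Prop :=
  ∃ φ : ℂ → ℂ, RepresentsComp β T φ

/-- `T` is a weighted composition operator `f ↦ w · (f ∘ φ)` on `H²(𝔻)`. -/
def IsWeightedCompOp (T : WH2 →L[ℂ] WH2) : Prop :=
  ∃ w φ : ℂ → ℂ, DifferentiableOn ℂ w uDisc ∧ DifferentiableOn ℂ φ uDisc ∧
    MapsTo φ uDisc uDisc ∧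
    ∀ f : WH2, ∀ z ∈ uDisc, wToFun hardyW (T f) z = w z * wToFun hardyW f (φ z)

section Semigroup

variable {X : Type*} [NormedAddCommGroup X] [NormedSpace ℂ X]

/-- `T` is a `C₀`-semigroup (indexed by `t ≥ 0`). -/
def IsC0Semigroup (T : ℝ → X →L[ℂ] X) : Prop :=
  T 0 = 1 ∧ (∀ s t : ℝ, 0 ≤ s → 0 ≤ t → T (s + t) = (T s).comp (T t)) ∧
  ∀ x : X, Tendsto (fun t : ℝ => T t x) (𝓝[≥] 0) (𝓝 x)

/-- `T` is a `C₀`-group (indexed by `t ∈ ℝ`). -/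
def IsC0Group (T : ℝ → X →L[ℂ] X) : Prop :=
  T 0 = 1 ∧ (∀ s t : ℝ, T (s + t) = (T s).comp (T t)) ∧
  ∀ x : X, Tendsto (fun t : ℝ => T t x) (𝓝 0) (𝓝 x)

/-- Quasicontractive: `‖T(t)‖ ≤ e^{wt}` for some `w ≥ 0` and all `t ≥ 0`. -/
def Quasicontractive (T : ℝ → X →L[ℂ] X) : Prop :=
  ∃ w : ℝ, 0 ≤ w ∧ ∀ t : ℝ, 0 ≤ t → ‖T t‖ ≤ Real.exp (w * t)

/-- The sector `Σ_θ = {re^{iα} : r ≥ 0, |α| < θ}` (note `arg 0 = 0`). -/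
def Sector (θ : ℝ) : Set ℂ := {z : ℂ | |Complex.arg z| < θ}

/-- `Te` is an analytic extension of the semigroup `T` to the sector `Σ_θ`,
bounded on `Σ_θ ∩ 𝔻`. -/
def IsAnalyticExtension (T : ℝ → X →L[ℂ] X) (θ : ℝ) (Te : ℂ → X →L[ℂ] X) : Prop :=
  (∀ t : ℝ, 0 ≤ t → Te t = T t) ∧
  DifferentiableOn ℂ Te (Sector θ \ {0}) ∧
  ∃ M : ℝ, ∀ ξ ∈ Sector θ, ‖ξ‖ < 1 → ‖Te ξ‖ ≤ M

/-- The semigroup `T` extends analytically and boundedly to the sector `Σ_θ`. -/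
def HasAnalyticExtension (T : ℝ → X →L[ℂ] X) (θ : ℝ) : Prop :=
  ∃ Te : ℂ → X →L[ℂ] X, IsAnalyticExtension T θ Te

/-- The semigroup `T` is analytic (on some sector `Σ_θ`, `θ ∈ (0, π/2]`). -/
def IsAnalyticSemigroup (T : ℝ → X →L[ℂ] X) : Prop :=
  ∃ θ ∈ Set.Ioc 0 (π / 2), HasAnalyticExtension T θ

/-- `y` is the limit of `(T(t)x - x)/t` as `t → 0⁺`. -/
def GenLimit (T : ℝ → X →L[ℂ] X) (x y : X) : Prop :=
  Tendsto (fun t : ℝ => (t : ℂ)⁻¹ • (T t x - x)) (𝓝[>] 0) (𝓝 y)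

/-- `A`, with domain `D`, is the infinitesimal generator of the semigroup `T`. -/
def IsGenerator (T : ℝ → X →L[ℂ] X) (D : Set X) (A : X → X) : Prop :=
  (∀ x ∈ D, GenLimit T x (A x)) ∧ ∀ x : X, (∃ y, GenLimit T x y) → x ∈ D

/-- `y` is the two-sided limit of `(T(t)x - x)/t` as `t → 0` (for groups). -/
def GenLimitGrp (T : ℝ → X →L[ℂ] X) (x y : X) : Prop :=
  Tendsto (fun t : ℝ => (t : ℂ)⁻¹ • (T t x - x)) (𝓝[≠] 0) (𝓝 y)

/-- `A`, with domain `D`, is the infinitesimal generator of the group `T`. -/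
def IsGeneratorGrp (T : ℝ → X →L[ℂ] X) (D : Set X) (A : X → X) : Prop :=
  (∀ x ∈ D, GenLimitGrp T x (A x)) ∧ ∀ x : X, (∃ y, GenLimitGrp T x y) → x ∈ D

/-- Immediately compact semigroup: `T(t)` is compact for all `t > 0`. -/
def ImmediatelyCompact (T : ℝ → X →L[ℂ] X) : Prop :=
  ∀ t : ℝ, 0 < t → IsCompactOperator (T t)

/-- Eventually compact semigroup: `T(t)` is compact for all `t ≥ t₀`, some `t₀ > 0`. -/
def EventuallyCompact (T : ℝ → X →L[ℂ] X) : Prop :=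
  ∃ t₀ : ℝ, 0 < t₀ ∧ ∀ t : ℝ, t₀ ≤ t → IsCompactOperator (T t)

end Semigroup

/-- The natural domain of the operator `A f = G f'` in `H²(β)`: those `f` for which
`G · (wToFun β f)'` is realized by some element of `H²(β)`. -/
def domA (β : ℕ → ℝ) (G : ℂ → ℂ) : Set WH2 :=
  {f : WH2 | ∃ g : WH2, ∀ z ∈ uDisc, wToFun β g z = G z * deriv (wToFun β f) z}

open Classical in
/-- The operator `A f = G f'` on `H²(β)` (defined via choice on its natural domain). -/
def opA (β : ℕ → ℝ) (G : ℂ → ℂ) (f : WH2) : WH2 :=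
  if h : f ∈ domA β G then h.choose else 0

/-- `(φ_t)_{t ≥ 0}` is a (jointly continuous) semiflow of analytic self-maps of `𝔻`. -/
def IsSemiflow (φ : ℝ → ℂ → ℂ) : Prop :=
  (∀ z ∈ uDisc, φ 0 z = z) ∧
  (∀ t : ℝ, 0 ≤ t → DifferentiableOn ℂ (φ t) uDisc ∧ MapsTo (φ t) uDisc uDisc) ∧
  (∀ s t : ℝ, 0 ≤ s → 0 ≤ t → ∀ z ∈ uDisc, φ (s + t) z = φ s (φ t z)) ∧
  ContinuousOn (fun p : ℝ × ℂ => φ p.1 p.2) (Set.Ici 0 ×ˢ uDisc)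

/-- `G` is the infinitesimal generator of the semiflow `φ`: `∂φ_t/∂t = G ∘ φ_t`. -/
def SemiflowGenerator (φ : ℝ → ℂ → ℂ) (G : ℂ → ℂ) : Prop :=
  ∀ z ∈ uDisc, ∀ t : ℝ, 0 ≤ t → HasDerivAt (fun s : ℝ => φ s z) (G (φ t z)) t

/-- Hilbert–Schmidt operator on `WH2` (w.r.t. the standard orthonormal basis). -/
def IsHilbertSchmidt (T : WH2 →L[ℂ] WH2) : Prop :=
  Summable (fun n : ℕ => ‖T (lp.single 2 n (1 : ℂ))‖ ^ 2)

/-- Trace-class operator on `WH2`: a product of two Hilbert–Schmidt operators. -/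
def IsTraceClass (T : WH2 →L[ℂ] WH2) : Prop :=
  ∃ A B : WH2 →L[ℂ] WH2, IsHilbertSchmidt A ∧ IsHilbertSchmidt B ∧ T = A.comp B

/-- `‖φ‖_∞ < 1` for a function on the unit disc. -/
def SupNormLtOne (φ : ℂ → ℂ) : Prop :=
  ∃ r : ℝ, r < 1 ∧ ∀ z ∈ uDisc, ‖φ z‖ ≤ r

/-- Essential boundary condition via radial limits: for almost every boundary point
`ξ = e^{it}`, whenever the radial limit `L` of `G` at `ξ` exists,
`Re (e^{iα} ξ̄ L) ≤ c`.  (This encodes `ess sup_(z ∈ 𝕋) Re (e^{iα} z̄ G(z)) ≤ c`.) -/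
def BoundaryReLe (G : ℂ → ℂ) (α : ℝ) (c : ℝ) : Prop :=
  ∀ᵐ t : ℝ, ∀ L : ℂ,
    Tendsto (fun r : ℝ => G ((r : ℂ) * Complex.exp ((t : ℂ) * Complex.I)))
      (𝓝[<] 1) (𝓝 L) →
    (Complex.exp ((α : ℂ) * Complex.I) *
      (starRingEnd ℂ) (Complex.exp ((t : ℂ) * Complex.I)) * L).re ≤ c

/-- `Re (z̄ G(z)) = 0` almost everywhere on the unit circle, via radial limits. -/
def BoundaryReEqZero (G : ℂ → ℂ) : Prop :=
  ∀ᵐ t : ℝ, ∀ L : ℂ,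
    Tendsto (fun r : ℝ => G ((r : ℂ) * Complex.exp ((t : ℂ) * Complex.I)))
      (𝓝[<] 1) (𝓝 L) →
    ((starRingEnd ℂ) (Complex.exp ((t : ℂ) * Complex.I)) * L).re = 0

end

/-- **Parseval's identity** on the unit circle for an absolutely convergent power series. -/
theorem circleAverage_norm_sq_tsum {b : ℕ → ℂ} (hb : Summable fun n => ‖b n‖) :
    Real.circleAverage (fun z => ‖∑' n, b n * z ^ n‖ ^ 2) 0 1 = ∑' n, ‖b n‖ ^ 2 := by
  let p : ℕ → Polynomial ℂ := fun N => ∑ n ∈ Finset.range N, Polynomial.monomial n (b n)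
  have hcoeff : ∀ N k, (p N).coeff k = if k < N then b k else 0 := by
    intro N k
    simp [p, Polynomial.finsetSum_coeff, Polynomial.coeff_monomial]
  have hsum : ∀ N, ∑ i ∈ (p N).support, ‖(p N).coeff i‖ ^ 2 =
      ∑ n ∈ Finset.range N, ‖b n‖ ^ 2 := by
    intro N
    rw [Finset.sum_subset (s₂ := Finset.range N)]
    · refine Finset.sum_congr rfl fun n hn => ?_
      simp [hcoeff, Finset.mem_range.1 hn]
    · intro n hn
      by_contra h
      simp [hcoeff, Finset.mem_range] at hn h
      omega
    · intro n _ hn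
      simp [Polynomial.notMem_support_iff.1 hn]
  have hsq : Summable fun n => ‖b n‖ ^ 2 := by
    refine Summable.of_norm_bounded_eventually_nat hb ?_
    filter_upwards [hb.tendsto_atTop_zero.eventually (ge_mem_nhds (zero_lt_one))] with n hn
    rw [Real.norm_of_nonneg (by positivity), sq]
    exact mul_le_of_le_one_left (norm_nonneg _) hn
  have hnorm : ∀ θ : ℝ, ∀ n, ‖b n * circleMap 0 1 θ ^ n‖ = ‖b n‖ := by
    intro θ n
    simp
  have heval : ∀ N θ, (p N).eval (circleMap 0 1 θ) =
      ∑ n ∈ Finset.range N, b n * circleMap 0 1 θ ^ n := by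
    intro N θ
    simp [p, Polynomial.eval_finsetSum]
  have hlim : Tendsto (fun N => Real.circleAverage (fun z => ‖(p N).eval z‖ ^ 2) 0 1) atTop
      (𝓝 (Real.circleAverage (fun z => ‖∑' n, b n * z ^ n‖ ^ 2) 0 1)) := by
    unfold Real.circleAverage
    refine Tendsto.const_smul ?_ _
    refine intervalIntegral.tendsto_integral_filter_of_dominated_convergence
      (fun _ => (∑' n, ‖b n‖) ^ 2) ?_ ?_ ?_ ?_
    · refine Eventually.of_forall fun N => Continuous.aestronglyMeasurable ?_
      have := (p N).continuous
      fun_prop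
    · refine Eventually.of_forall fun N => ae_of_all _ fun θ _ => ?_
      rw [Real.norm_of_nonneg (by positivity)]
      beta_reduce
      rw [heval]
      gcongr
      refine (norm_sum_le _ _).trans ?_
      simp_rw [hnorm]
      exact hb.sum_le_tsum _ fun _ _ => norm_nonneg _
    · exact intervalIntegrable_const
    · refine ae_of_all _ fun θ _ => ?_
      have hs : Summable fun n => b n * circleMap 0 1 θ ^ n :=
        Summable.of_norm (by simpa only [hnorm] using hb)
      simp_rw [heval]
      exact (hs.hasSum.tendsto_sum_nat.norm).pow 2
  have h2 : Tendsto (fun N => Real.circleAverage (fun z => ‖(p N).eval z‖ ^ 2) 0 1) atTop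
      (𝓝 (∑' n, ‖b n‖ ^ 2)) := by
    simp_rw [← Polynomial.sum_sq_norm_coeff_eq_circleAverage, hsum]
    exact hsq.hasSum.tendsto_sum_nat
  exact tendsto_nhds_unique hlim h2

theorem setLIntegral_enorm_sq_tsum_circle {b : ℕ → ℂ} (hb : Summable fun n => ‖b n‖) :
    ∫⁻ θ in Ioo (-π) π, ‖∑' n, b n * (Complex.exp (θ * Complex.I)) ^ n‖ₑ ^ 2 =
      ENNReal.ofReal (2 * π) * ∑' n, ‖b n‖ₑ ^ 2 := by
  have hsq : Summable fun n => ‖b n‖ ^ 2 := by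
    refine Summable.of_norm_bounded_eventually_nat hb ?_
    filter_upwards [hb.tendsto_atTop_zero.eventually (ge_mem_nhds (zero_lt_one))] with n hn
    rw [Real.norm_of_nonneg (by positivity), sq]
    exact mul_le_of_le_one_left (norm_nonneg _) hn
  have hcont : Continuous fun θ : ℝ => ∑' n, b n * (Complex.exp (θ * Complex.I)) ^ n := by
    refine continuous_tsum (fun n => by fun_prop) hb fun n θ => ?_
    simp [Complex.norm_exp_ofReal_mul_I]
  set g : ℝ → ℝ := fun θ => ‖∑' n, b n * (Complex.exp (θ * Complex.I)) ^ n‖ ^ 2 with hg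
  have hgc : Continuous g := by fun_prop
  have hper : Function.Periodic g (2 * π) := by
    intro θ
    simp only [hg]
    congr 3
    ext n
    congr 2
    push_cast
    rw [add_mul, Complex.exp_add, Complex.exp_two_pi_mul_I, mul_one]
  have hint : ∫ θ in (-π)..π, g θ = 2 * π * ∑' n, ‖b n‖ ^ 2 := by
    have h1 := hper.intervalIntegral_add_eq (-π) 0
    rw [show -π + 2 * π = π by ring, zero_add] at h1
    rw [h1, ← circleAverage_norm_sq_tsum hb, Real.circleAverage, smul_eq_mul]
    have : (2 * π) ≠ 0 := by positivity
    field_simp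
    simp [hg, circleMap]
  calc _ = ∫⁻ θ in Ioo (-π) π, ENNReal.ofReal (g θ) := by
        refine lintegral_congr fun θ => ?_
        rw [hg, ENNReal.ofReal_pow (norm_nonneg _), ofReal_norm]
    _ = ENNReal.ofReal (∫ θ in Ioo (-π) π, g θ) := by
        rw [ofReal_integral_eq_lintegral_ofReal]
        · exact (hgc.integrableOn_Icc (a := -π) (b := π)).mono_set Ioo_subset_Icc_self
        · exact ae_of_all _ fun θ => by positivity
    _ = _ := by
        rw [← integral_Ioc_eq_integral_Ioo,
          ← intervalIntegral.integral_of_le (by linarith [Real.pi_pos]),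
          hint, ENNReal.ofReal_mul (by positivity), ENNReal.ofReal_tsum_of_nonneg
            (fun _ => by positivity) hsq]
        congr 2
        ext n
        rw [ENNReal.ofReal_pow (norm_nonneg _), ofReal_norm]

/-- Radially weighted area integral of `|F|²` in terms of the Taylor coefficients of `F`. -/
theorem setLIntegral_uDisc_enorm_sq {a : ℕ → ℂ} {F : ℂ → ℂ} {W : ℝ → ℝ}
    (hF : ContinuousOn F uDisc) (hW : Continuous W)
    (ha : ∀ z ∈ uDisc, HasSum (fun n => a n * z ^ n) (F z)) :
    ∫⁻ z in uDisc, ‖F z‖ₑ ^ 2 * ENNReal.ofReal (W ‖z‖) =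
      ∑' n, ‖a n‖ₑ ^ 2 *
        (ENNReal.ofReal (2 * π) *
          ∫⁻ r in Ioo (0 : ℝ) 1, ENNReal.ofReal (r ^ (2 * n + 1)) * ENNReal.ofReal (W r)) := by
  have hmD : MeasurableSet uDisc := measurableSet_ball
  set H : ℂ → ℝ≥0∞ := uDisc.indicator fun z => ‖F z‖ₑ ^ 2 * ENNReal.ofReal (W ‖z‖) with hH
  have hHm : Measurable H := by
    have hF' : Measurable (uDisc.indicator F) := by
      classical
      rw [← piecewise_eq_indicator]
      exact hF.measurable_piecewise continuousOn_const hmD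
    have hH' : H = uDisc.indicator fun z => ‖uDisc.indicator F z‖ₑ ^ 2 *
        ENNReal.ofReal (W ‖z‖) := by
      refine indicator_congr fun z hz => ?_
      rw [indicator_of_mem hz]
    rw [hH']
    refine Measurable.indicator ?_ hmD
    fun_prop
  rw [← lintegral_indicator hmD, ← Complex.lintegral_comp_polarCoord_symm]
  change ∫⁻ p in polarCoord.target, ENNReal.ofReal p.1 • H (Complex.polarCoord.symm p) = _
  rw [show polarCoord.target = Ioi (0 : ℝ) ×ˢ Ioo (-π) π from rfl, Measure.volume_eq_prod,
    ← Measure.prod_restrict, lintegral_prod]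
  swap
  · simp only [Complex.polarCoord_symm_apply, smul_eq_mul]
    fun_prop
  have hpt : ∀ r : ℝ, 0 < r → ∀ θ : ℝ, ‖(r : ℂ) * (Real.cos θ + Real.sin θ * Complex.I)‖ = r := by
    intro r hr θ
    have := Complex.norm_polarCoord_symm (r, θ)
    rwa [Complex.polarCoord_symm_apply, abs_of_pos hr] at this
  calc _ = ∫⁻ r in Ioi (0 : ℝ), (Ioo (0 : ℝ) 1).indicator (fun r =>
        ∑' n, ‖a n‖ₑ ^ 2 * (ENNReal.ofReal (2 * π) * (ENNReal.ofReal (r ^ (2 * n + 1)) *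
          ENNReal.ofReal (W r)))) r := by
        refine setLIntegral_congr_fun measurableSet_Ioi fun r hr => ?_
        have hr0 : 0 < r := hr
        simp only [Complex.polarCoord_symm_apply, smul_eq_mul]
        by_cases h1 : r < 1
        · rw [indicator_of_mem (show r ∈ Ioo 0 1 from ⟨hr0, h1⟩)]
          have hin : ∀ θ : ℝ, (r : ℂ) * (Real.cos θ + Real.sin θ * Complex.I) ∈ uDisc := by
            intro θ
            rw [uDisc, mem_ball_zero_iff, hpt r hr0]
            exact h1
          have hs : Summable fun n => ‖a n * (r : ℂ) ^ n‖ := by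
            refine ((ha (r : ℂ) ?_).summable).norm
            rw [uDisc, mem_ball_zero_iff]
            simpa [abs_of_pos hr0] using h1
          have hval : ∀ θ : ℝ, H ((r : ℂ) * (Real.cos θ + Real.sin θ * Complex.I)) =
              ‖∑' n, a n * (r : ℂ) ^ n * (Complex.exp (θ * Complex.I)) ^ n‖ₑ ^ 2 *
                ENNReal.ofReal (W r) := by
            intro θ
            rw [hH, indicator_of_mem (hin θ), hpt r hr0, ← (ha _ (hin θ)).tsum_eq]
            congr 4
            ext n
            rw [mul_pow, ← mul_assoc, Complex.exp_mul_I]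
            push_cast
            rfl
          simp_rw [hval]
          rw [lintegral_const_mul' _ _ ENNReal.ofReal_ne_top,
            lintegral_mul_const' _ _ ENNReal.ofReal_ne_top, setLIntegral_enorm_sq_tsum_circle hs,
            ← ENNReal.tsum_mul_left, ← ENNReal.tsum_mul_right, ← ENNReal.tsum_mul_left]
          congr 1
          ext n
          have : ‖a n * (r : ℂ) ^ n‖ₑ ^ 2 = ‖a n‖ₑ ^ 2 * ENNReal.ofReal (r ^ (2 * n)) := by
            rw [enorm_mul, mul_pow, enorm_pow, ← ofReal_norm (r : ℂ), Complex.norm_real,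
              Real.norm_of_nonneg hr0.le, ← pow_mul, mul_comm n 2, ENNReal.ofReal_pow hr0.le]
          rw [this, pow_succ r, ENNReal.ofReal_mul (p := r ^ (2 * n)) (by positivity)]
          ring
        · rw [indicator_of_notMem (fun h => h1 h.2)]
          have : ∀ θ : ℝ, H ((r : ℂ) * (Real.cos θ + Real.sin θ * Complex.I)) = 0 := by
            intro θ
            rw [hH, indicator_of_notMem]
            rw [uDisc, mem_ball_zero_iff, hpt r hr0]
            exact h1
          simp_rw [this, mul_zero, lintegral_zero]
    _ = ∫⁻ r in Ioo (0 : ℝ) 1,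
        ∑' n, ‖a n‖ₑ ^ 2 * (ENNReal.ofReal (2 * π) * (ENNReal.ofReal (r ^ (2 * n + 1)) *
          ENNReal.ofReal (W r))) := by
        rw [setLIntegral_indicator measurableSet_Ioo,
          inter_eq_left.2 Ioo_subset_Ioi_self]
    _ = _ := by
        rw [lintegral_tsum (fun n => by fun_prop)]
        congr 1
        ext n
        rw [lintegral_const_mul' _ _ (by simp), lintegral_const_mul' _ _ ENNReal.ofReal_ne_top]

/-- The `n`-th Taylor coefficient of `h` at the origin. -/
noncomputable def taylorCoeff (n : ℕ) (h : ℂ → ℂ) : ℂ := (n.factorial : ℂ)⁻¹ * iteratedDeriv n h 0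

theorem isOpen_uDisc : IsOpen uDisc := isOpen_ball

theorem mem_uDisc {z : ℂ} : z ∈ uDisc ↔ ‖z‖ < 1 := mem_ball_zero_iff

theorem zero_mem_uDisc : (0 : ℂ) ∈ uDisc := mem_ball_self one_pos

theorem hasSum_taylorCoeff {h : ℂ → ℂ} (hh : DifferentiableOn ℂ h uDisc) {z : ℂ}
    (hz : z ∈ uDisc) : HasSum (fun n => taylorCoeff n h * z ^ n) (h z) := by
  have hs := Complex.hasSum_taylorSeries_on_ball hh hz
  refine hs.congr_fun fun n => ?_
  simp only [taylorCoeff, sub_zero, smul_eq_mul]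
  ring

theorem taylorCoeff_zero (h : ℂ → ℂ) : taylorCoeff 0 h = h 0 := by
  simp [taylorCoeff]

theorem taylorCoeff_deriv (n : ℕ) (h : ℂ → ℂ) :
    taylorCoeff n (deriv h) = (n + 1) * taylorCoeff (n + 1) h := by
  rw [taylorCoeff, taylorCoeff, iteratedDeriv_succ', Nat.factorial_succ]
  have h1 : ((n : ℂ) + 1) ≠ 0 := Nat.cast_add_one_ne_zero n
  have h2 : (n.factorial : ℂ) ≠ 0 := Nat.cast_ne_zero.2 n.factorial_ne_zero
  push_cast
  field_simp

theorem hasFPowerSeriesOnBall_of_hasSum {a : ℕ → ℂ} {h : ℂ → ℂ}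
    (ha : ∀ z ∈ uDisc, HasSum (fun n => a n * z ^ n) (h z)) :
    HasFPowerSeriesOnBall h (FormalMultilinearSeries.ofScalars ℂ a) 0 1 where
  r_le := by
    refine ENNReal.le_of_forall_nnreal_lt fun r hr => ?_
    have hr1 : (r : ℝ) < 1 := by exact_mod_cast hr
    refine FormalMultilinearSeries.le_radius_of_summable _ ?_
    have hs := (ha (r : ℝ) (by simpa [mem_uDisc] using hr1)).summable.norm
    simpa [FormalMultilinearSeries.ofScalars_norm] using hs
  r_pos := one_pos
  hasSum := by
    intro y hy
    have hy' : y ∈ uDisc := by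
      rw [mem_uDisc]
      rw [mem_eball, edist_zero_right] at hy
      simpa [← ofReal_norm] using hy
    simpa [FormalMultilinearSeries.ofScalars_apply_eq, mul_comm] using ha y hy'

theorem differentiableOn_of_hasSum {a : ℕ → ℂ} {h : ℂ → ℂ}
    (ha : ∀ z ∈ uDisc, HasSum (fun n => a n * z ^ n) (h z)) : DifferentiableOn ℂ h uDisc := by
  have := (hasFPowerSeriesOnBall_of_hasSum ha).differentiableOn
  refine this.mono fun z hz => ?_
  rw [mem_uDisc] at hz
  rw [mem_eball, edist_zero_right, ← ofReal_norm, ENNReal.ofReal_lt_one]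
  exact hz

theorem taylorCoeff_eq_of_hasSum {a : ℕ → ℂ} {h : ℂ → ℂ}
    (ha : ∀ z ∈ uDisc, HasSum (fun n => a n * z ^ n) (h z)) (n : ℕ) : taylorCoeff n h = a n := by
  have := (hasFPowerSeriesOnBall_of_hasSum ha).factorial_smul 1 n
  rw [taylorCoeff, iteratedDeriv_eq_iteratedFDeriv, ← this]
  have h2 : (n.factorial : ℂ) ≠ 0 := Nat.cast_ne_zero.2 n.factorial_ne_zero
  simp [h2]

/-- The normalized area integral of `|f'|²` with the radial weight `W` is an equivalent square
norm, modulo constants, on `H²(β)`. -/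
structure IsAreaWeight (β : ℕ → ℝ) (W : ℝ → ℝ) : Prop where
  weight_zero : β 0 = 1
  one_le : ∀ n, 1 ≤ β n
  cont : Continuous W
  nonneg : ∀ r, 0 ≤ r → r ≤ 1 → 0 ≤ W r
  le_one : ∀ r, W r ≤ 1
  moment_le : ∀ n : ℕ, ENNReal.ofReal ((n + 1) ^ 2) * (ENNReal.ofReal (2 * π) *
    ∫⁻ r in Ioo (0 : ℝ) 1, ENNReal.ofReal (r ^ (2 * n + 1)) * ENNReal.ofReal (W r)) ≤
      ENNReal.ofReal π * ENNReal.ofReal (β (n + 1) ^ 2)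
  le_moment : ∀ n : ℕ, ENNReal.ofReal π * ENNReal.ofReal (β (n + 1) ^ 2) ≤
    2 * (ENNReal.ofReal ((n + 1) ^ 2) * (ENNReal.ofReal (2 * π) *
      ∫⁻ r in Ioo (0 : ℝ) 1, ENNReal.ofReal (r ^ (2 * n + 1)) * ENNReal.ofReal (W r)))
  le_mul : ∀ K r s : ℝ, 1 ≤ K → 1 - r ^ 2 ≤ K * (1 - s ^ 2) → W r ≤ K * W s

theorem setLIntegral_Ioo_pow (n : ℕ) :
    ∫⁻ r in Ioo (0 : ℝ) 1, ENNReal.ofReal (r ^ n) = ENNReal.ofReal (1 / (n + 1)) := by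
  rw [← ofReal_integral_eq_lintegral_ofReal, ← integral_Ioc_eq_integral_Ioo,
    ← intervalIntegral.integral_of_le zero_le_one, integral_pow]
  · simp
  · exact ((continuous_pow n).integrableOn_Icc (a := 0) (b := 1)).mono_set Ioo_subset_Icc_self
  · filter_upwards [ae_restrict_mem measurableSet_Ioo] with r hr
    exact pow_nonneg hr.1.le n

theorem setLIntegral_Ioo_pow_mul (n : ℕ) :
    ∫⁻ r in Ioo (0 : ℝ) 1, ENNReal.ofReal (r ^ (2 * n + 1)) * ENNReal.ofReal (1 - r ^ 2) =
      ENNReal.ofReal (1 / (2 * (n + 1) * (n + 2))) := by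
  have : ∀ r ∈ Ioo (0 : ℝ) 1, ENNReal.ofReal (r ^ (2 * n + 1)) * ENNReal.ofReal (1 - r ^ 2) =
      ENNReal.ofReal (r ^ (2 * n + 1) - r ^ (2 * n + 3)) := by
    intro r hr
    rw [← ENNReal.ofReal_mul (pow_nonneg hr.1.le _)]
    congr 1
    ring
  rw [setLIntegral_congr_fun measurableSet_Ioo this, ← ofReal_integral_eq_lintegral_ofReal,
    ← integral_Ioc_eq_integral_Ioo, ← intervalIntegral.integral_of_le zero_le_one,
    intervalIntegral.integral_sub (by simp) (by simp), integral_pow, integral_pow]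
  · congr 1
    push_cast
    have : (n : ℝ) + 1 ≠ 0 := by positivity
    have : (n : ℝ) + 2 ≠ 0 := by positivity
    have : (2 * n : ℝ) + 1 + 1 ≠ 0 := by positivity
    have : (2 * n : ℝ) + 3 + 1 ≠ 0 := by positivity
    simp
    field_simp
    ring
  · exact (Continuous.integrableOn_Icc (by fun_prop) (a := 0) (b := 1)).mono_set
      Ioo_subset_Icc_self
  · filter_upwards [ae_restrict_mem measurableSet_Ioo] with r hr
    have : r ^ (2 * n + 3) ≤ r ^ (2 * n + 1) :=
      pow_le_pow_of_le_one hr.1.le hr.2.le (by omega)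
    simpa using this

theorem isAreaWeight_dirichletW : IsAreaWeight dirichletW (fun _ => 1) := by
  have hm : ∀ n : ℕ, ENNReal.ofReal ((n + 1) ^ 2) * (ENNReal.ofReal (2 * π) *
      ∫⁻ r in Ioo (0 : ℝ) 1, ENNReal.ofReal (r ^ (2 * n + 1)) * ENNReal.ofReal 1) =
      ENNReal.ofReal π * ENNReal.ofReal (dirichletW (n + 1) ^ 2) := by
    intro n
    simp only [ENNReal.ofReal_one, mul_one]
    rw [setLIntegral_Ioo_pow, ← ENNReal.ofReal_mul (by positivity),
      ← ENNReal.ofReal_mul (by positivity), ← ENNReal.ofReal_mul (by positivity), dirichletW,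
      if_neg n.succ_ne_zero, Real.sq_sqrt (by positivity)]
    congr 1
    push_cast
    field_simp
    ring
  refine ⟨by simp [dirichletW], fun n => ?_, continuous_const, by simp, by simp,
    fun n => (hm n).le, fun n => ?_, by intros; linarith⟩
  · rcases Nat.eq_zero_or_pos n with rfl | hn
    · simp [dirichletW]
    · rw [dirichletW, if_neg hn.ne', Real.one_le_sqrt]
      exact_mod_cast hn
  · rw [hm]
    exact le_mul_of_one_le_left zero_le one_le_two

theorem isAreaWeight_hardyW : IsAreaWeight hardyW (fun r => 1 - r ^ 2) := by
  have hm : ∀ n : ℕ, ENNReal.ofReal ((n + 1) ^ 2) * (ENNReal.ofReal (2 * π) *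
      ∫⁻ r in Ioo (0 : ℝ) 1, ENNReal.ofReal (r ^ (2 * n + 1)) * ENNReal.ofReal (1 - r ^ 2)) =
      ENNReal.ofReal (π * ((n + 1) / (n + 2))) := by
    intro n
    rw [setLIntegral_Ioo_pow_mul, ← ENNReal.ofReal_mul (by positivity),
      ← ENNReal.ofReal_mul (by positivity)]
    congr 1
    field_simp
  refine ⟨rfl, fun n => le_rfl, by fun_prop, fun r h0 h1 => ?_, fun r => ?_, fun n => ?_,
    fun n => ?_, fun K r s _ h => h⟩
  · nlinarith
  · nlinarith [sq_nonneg r]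
  · rw [hm, ← ENNReal.ofReal_mul (by positivity)]
    refine ENNReal.ofReal_le_ofReal ?_
    simp only [hardyW]
    gcongr
    rw [one_pow, div_le_one (by positivity)]
    linarith
  · rw [hm, ← ENNReal.ofReal_mul (by positivity), show (2 : ℝ≥0∞) = ENNReal.ofReal 2 by simp,
      ← ENNReal.ofReal_mul (by positivity)]
    refine ENNReal.ofReal_le_ofReal ?_
    have h1 : (1 : ℝ) / 2 ≤ (n + 1) / (n + 2) := by
      rw [div_le_div_iff₀ (by positivity) (by positivity)]
      linarith [(Nat.cast_nonneg n : (0 : ℝ) ≤ n)]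
    simp only [hardyW]
    nlinarith [Real.pi_pos]

/-- The weighted area integral of `|h'|²` over the disc. -/
noncomputable def areaEnergy (W : ℝ → ℝ) (h : ℂ → ℂ) : ℝ≥0∞ :=
  ∫⁻ z in uDisc, ‖deriv h z‖ₑ ^ 2 * ENNReal.ofReal (W ‖z‖)

theorem areaEnergy_eq_tsum {W : ℝ → ℝ} (hW : Continuous W) {h : ℂ → ℂ}
    (hh : DifferentiableOn ℂ h uDisc) :
    areaEnergy W h = ∑' n : ℕ, ‖taylorCoeff (n + 1) h‖ₑ ^ 2 *
      (ENNReal.ofReal ((n + 1) ^ 2) * (ENNReal.ofReal (2 * π) *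
        ∫⁻ r in Ioo (0 : ℝ) 1, ENNReal.ofReal (r ^ (2 * n + 1)) * ENNReal.ofReal (W r))) := by
  have hd : DifferentiableOn ℂ (deriv h) uDisc := hh.deriv isOpen_uDisc
  rw [areaEnergy, setLIntegral_uDisc_enorm_sq hd.continuousOn hW
    fun z hz => hasSum_taylorCoeff hd hz]
  congr 1
  ext n
  have h1 : ‖((n : ℂ) + 1)‖ₑ ^ 2 = ENNReal.ofReal ((n + 1) ^ 2) := by
    rw [← ofReal_norm, ← ENNReal.ofReal_pow (norm_nonneg _)]
    congr 2
    exact_mod_cast Complex.norm_natCast (n + 1)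
  rw [taylorCoeff_deriv, enorm_mul, mul_pow, h1]
  ring

theorem enorm_ofReal_mul_sq {b : ℝ} (hb : 0 ≤ b) (c : ℂ) :
    ‖(b : ℂ) * c‖ₑ ^ 2 = ‖c‖ₑ ^ 2 * ENNReal.ofReal (b ^ 2) := by
  rw [enorm_mul, mul_pow, ← ofReal_norm (b : ℂ), Complex.norm_real, Real.norm_of_nonneg hb,
    ENNReal.ofReal_pow hb, mul_comm]

section AreaWeight

variable {β : ℕ → ℝ} {W : ℝ → ℝ}

theorem IsAreaWeight.pos (hβ : IsAreaWeight β W) (n : ℕ) : 0 < β n :=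
  one_pos.trans_le (hβ.one_le n)

theorem IsAreaWeight.areaEnergy_le (hβ : IsAreaWeight β W) {h : ℂ → ℂ}
    (hh : DifferentiableOn ℂ h uDisc) :
    areaEnergy W h ≤ ENNReal.ofReal π * ∑' n, ‖(β (n + 1) : ℂ) * taylorCoeff (n + 1) h‖ₑ ^ 2 := by
  rw [areaEnergy_eq_tsum hβ.cont hh, ← ENNReal.tsum_mul_left]
  refine ENNReal.tsum_le_tsum fun n => ?_
  rw [enorm_ofReal_mul_sq (hβ.pos _).le, mul_left_comm (ENNReal.ofReal π)]
  exact mul_le_mul_right (hβ.moment_le n) _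

theorem IsAreaWeight.le_areaEnergy (hβ : IsAreaWeight β W) {h : ℂ → ℂ}
    (hh : DifferentiableOn ℂ h uDisc) :
    ENNReal.ofReal π * ∑' n, ‖(β (n + 1) : ℂ) * taylorCoeff (n + 1) h‖ₑ ^ 2 ≤
      2 * areaEnergy W h := by
  rw [areaEnergy_eq_tsum hβ.cont hh, ← ENNReal.tsum_mul_left, ← ENNReal.tsum_mul_left]
  refine ENNReal.tsum_le_tsum fun n => ?_
  rw [enorm_ofReal_mul_sq (hβ.pos _).le, mul_left_comm, mul_left_comm 2]
  exact mul_le_mul_right (hβ.le_moment n) _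

theorem norm_div_weight_le (hβ : ∀ n, 1 ≤ β n) (f : WH2) (n : ℕ) :
    ‖f n / (β n : ℂ)‖ ≤ ‖f‖ := by
  have h1 := lp.norm_apply_le_norm (by simp) f n
  rw [norm_div, Complex.norm_real, Real.norm_of_nonneg (zero_le_one.trans (hβ n))]
  exact (div_le_self (norm_nonneg _) (hβ n)).trans h1

theorem hasSum_wToFun (hβ : ∀ n, 1 ≤ β n) (f : WH2) {z : ℂ} (hz : z ∈ uDisc) :
    HasSum (fun n => f n / (β n : ℂ) * z ^ n) (wToFun β f z) := by
  refine Summable.hasSum (Summable.of_norm_bounded (g := fun n => ‖f‖ * ‖z‖ ^ n)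
    ((summable_geometric_of_lt_one (norm_nonneg _) (mem_uDisc.1 hz)).mul_left _) fun n => ?_)
  rw [norm_mul, norm_pow]
  gcongr
  exact norm_div_weight_le hβ f n

theorem norm_wToFun_le (hβ : ∀ n, 1 ≤ β n) (f : WH2) {z : ℂ} (hz : z ∈ uDisc) :
    ‖wToFun β f z‖ ≤ (1 - ‖z‖)⁻¹ * ‖f‖ := by
  rw [mul_comm]
  refine tsum_of_norm_bounded ((hasSum_geometric_of_lt_one (norm_nonneg _)
    (mem_uDisc.1 hz)).mul_left ‖f‖) fun n => ?_
  rw [norm_mul, norm_pow]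
  gcongr
  exact norm_div_weight_le hβ f n

theorem differentiableOn_wToFun (hβ : ∀ n, 1 ≤ β n) (f : WH2) :
    DifferentiableOn ℂ (wToFun β f) uDisc :=
  differentiableOn_of_hasSum fun _ hz => hasSum_wToFun hβ f hz

theorem taylorCoeff_wToFun (hβ : ∀ n, 1 ≤ β n) (f : WH2) (n : ℕ) :
    taylorCoeff n (wToFun β f) = f n / (β n : ℂ) :=
  taylorCoeff_eq_of_hasSum (fun _ hz => hasSum_wToFun hβ f hz) n

theorem wToFun_injective (hβ : ∀ n, 1 ≤ β n) {f g : WH2}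
    (h : ∀ z ∈ uDisc, wToFun β f z = wToFun β g z) : f = g := by
  ext n
  have h1 := taylorCoeff_wToFun hβ f n
  rw [taylorCoeff_eq_of_hasSum (h := wToFun β f)
    (fun z hz => by rw [h z hz]; exact hasSum_wToFun hβ g hz) n] at h1
  have : (β n : ℂ) ≠ 0 := by exact_mod_cast (one_pos.trans_le (hβ n)).ne'
  field_simp at h1
  exact h1.symm

theorem wToFun_add (hβ : ∀ n, 1 ≤ β n) (f g : WH2) {z : ℂ} (hz : z ∈ uDisc) :
    wToFun β (f + g) z = wToFun β f z + wToFun β g z := by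
  refine HasSum.tsum_eq (((hasSum_wToFun hβ f hz).add (hasSum_wToFun hβ g hz)).congr_fun
    fun n => ?_)
  simp only [lp.coeFn_add, Pi.add_apply]
  ring

theorem wToFun_smul (hβ : ∀ n, 1 ≤ β n) (c : ℂ) (f : WH2) {z : ℂ} (hz : z ∈ uDisc) :
    wToFun β (c • f) z = c * wToFun β f z := by
  refine HasSum.tsum_eq (((hasSum_wToFun hβ f hz).mul_left c).congr_fun fun n => ?_)
  simp only [lp.coeFn_smul, Pi.smul_apply, smul_eq_mul]
  ring

/-- Evaluation at a point of the disc as a continuous linear functional on `H²(β)`. -/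
noncomputable def evalCLM (hβ : ∀ n, 1 ≤ β n) {z : ℂ} (hz : z ∈ uDisc) : WH2 →L[ℂ] ℂ :=
  LinearMap.mkContinuous
    { toFun := fun f => wToFun β f z
      map_add' := fun f g => wToFun_add hβ f g hz
      map_smul' := fun c f => wToFun_smul hβ c f hz } (1 - ‖z‖)⁻¹
    fun f => norm_wToFun_le hβ f hz

@[simp]
theorem evalCLM_apply (hβ : ∀ n, 1 ≤ β n) {z : ℂ} (hz : z ∈ uDisc) (f : WH2) :
    evalCLM hβ hz f = wToFun β f z := rfl

theorem wToFun_eW (hβ : ∀ n, 1 ≤ β n) (n : ℕ) (z : ℂ) : wToFun β (eW β n) z = z ^ n := by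
  have hn : (β n : ℂ) ≠ 0 := by exact_mod_cast (one_pos.trans_le (hβ n)).ne'
  rw [wToFun, tsum_eq_single n]
  · simp [eW, hn]
  · intro m hm
    simp [eW, hm]

theorem tsum_enorm_sq_eq (f : WH2) : ∑' n, ‖f n‖ₑ ^ 2 = ENNReal.ofReal (‖f‖ ^ 2) := by
  have h := lp.hasSum_norm (p := 2) (by simp) f
  simp only [ENNReal.toReal_ofNat, Real.rpow_ofNat] at h
  rw [← h.tsum_eq, ENNReal.ofReal_tsum_of_nonneg (fun _ => by positivity) h.summable]
  congr 1
  ext n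
  rw [ENNReal.ofReal_pow (norm_nonneg _), ofReal_norm]

theorem IsAreaWeight.areaEnergy_wToFun_le (hβ : IsAreaWeight β W) (f : WH2) :
    areaEnergy W (wToFun β f) ≤ ENNReal.ofReal (π * ‖f‖ ^ 2) := by
  refine (hβ.areaEnergy_le (differentiableOn_wToFun hβ.one_le f)).trans ?_
  rw [ENNReal.ofReal_mul Real.pi_pos.le, ← tsum_enorm_sq_eq,
    tsum_eq_zero_add' (f := fun n => ‖f n‖ₑ ^ 2) ENNReal.summable]
  gcongr
  refine le_add_of_nonneg_of_le zero_le (ENNReal.tsum_le_tsum fun n => ?_)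
  rw [taylorCoeff_wToFun hβ.one_le, mul_div_cancel₀]
  exact_mod_cast (hβ.pos _).ne'

/-- A holomorphic function with finite weighted area energy comes from an element of `H²(β)`. -/
theorem IsAreaWeight.exists_wToFun_eq (hβ : IsAreaWeight β W) {h : ℂ → ℂ}
    (hh : DifferentiableOn ℂ h uDisc) {E : ℝ} (hE : 0 ≤ E)
    (hhE : areaEnergy W h ≤ ENNReal.ofReal E) :
    ∃ g : WH2, (∀ z ∈ uDisc, wToFun β g z = h z) ∧ ‖g‖ ^ 2 ≤ ‖h 0‖ ^ 2 + E := by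
  have hle : ∑' n, ‖(β n : ℂ) * taylorCoeff n h‖ₑ ^ 2 ≤ ENNReal.ofReal (‖h 0‖ ^ 2 + E) := by
    rw [tsum_eq_zero_add' ENNReal.summable, ENNReal.ofReal_add (by positivity) hE]
    refine add_le_add ?_ (le_trans ?_ hhE)
    · rw [hβ.weight_zero, taylorCoeff_zero, ENNReal.ofReal_pow (norm_nonneg _), ofReal_norm]
      simp
    · have h1 := hβ.le_areaEnergy hh
      have h2 : (2 : ℝ≥0∞) ≤ ENNReal.ofReal π := by
        rw [show (2 : ℝ≥0∞) = ENNReal.ofReal 2 by simp]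
        exact ENNReal.ofReal_le_ofReal Real.two_le_pi
      have h3 := (mul_le_mul_left h2 _).trans h1
      rwa [ENNReal.mul_le_mul_iff_right two_ne_zero ENNReal.ofNat_ne_top] at h3
  have hmem : Memℓp (fun n => (β n : ℂ) * taylorCoeff n h) 2 := by
    refine memℓp_gen ?_
    simp only [ENNReal.toReal_ofNat, Real.rpow_ofNat]
    have := ENNReal.summable_toReal (hle.trans_lt ENNReal.ofReal_lt_top).ne
    simpa using this
  refine ⟨⟨_, hmem⟩, fun z hz => ?_, ?_⟩
  · rw [wToFun, ← (hasSum_taylorCoeff hh hz).tsum_eq]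
    congr 1
    ext n
    have : (β n : ℂ) ≠ 0 := by exact_mod_cast (hβ.pos n).ne'
    change (β n : ℂ) * taylorCoeff n h / β n * z ^ n = _
    rw [mul_div_cancel_left₀ _ this]
  · rw [← ENNReal.ofReal_le_ofReal_iff (by positivity), ← tsum_enorm_sq_eq]
    exact hle

end AreaWeight

theorem abs_det_smulRight_restrictScalars (c : ℂ) :
    |(((1 : ℂ →L[ℂ] ℂ).smulRight c).restrictScalars ℝ).det| = ‖c‖ ^ 2 := by
  have : (((1 : ℂ →L[ℂ] ℂ).smulRight c).restrictScalars ℝ : ℂ →ₗ[ℝ] ℂ) =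
      (c • LinearMap.id : ℂ →ₗ[ℂ] ℂ).restrictScalars ℝ := by
    ext; simp [mul_comm]
  rw [ContinuousLinearMap.det, this, LinearMap.det_restrictScalars, LinearMap.det_smul]
  simp [Algebra.norm_complex_eq, Complex.normSq_eq_norm_sq]

section Composition

variable {β : ℕ → ℝ} {W : ℝ → ℝ} {φ : ℂ → ℂ}

theorem deriv_comp_of_mapsTo {h : ℂ → ℂ} (hφ : DifferentiableOn ℂ φ uDisc)
    (hm : MapsTo φ uDisc uDisc) (hh : DifferentiableOn ℂ h uDisc) {z : ℂ} (hz : z ∈ uDisc) :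
    deriv (fun z => h (φ z)) z = deriv h (φ z) * deriv φ z :=
  ((hh.differentiableAt (isOpen_uDisc.mem_nhds (hm hz))).hasDerivAt.comp z
    (hφ.differentiableAt (isOpen_uDisc.mem_nhds hz)).hasDerivAt).deriv

/-- Composition with an injective self-map of the disc which does not approach the boundary too
fast is bounded for the weighted area energy. -/
theorem IsAreaWeight.areaEnergy_comp_le (hβ : IsAreaWeight β W)
    (hφ : DifferentiableOn ℂ φ uDisc) (hm : MapsTo φ uDisc uDisc) (hi : InjOn φ uDisc)
    {K : ℝ} (hK : 1 ≤ K) (hφK : ∀ z ∈ uDisc, 1 - ‖z‖ ^ 2 ≤ K * (1 - ‖φ z‖ ^ 2))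
    {h : ℂ → ℂ} (hh : DifferentiableOn ℂ h uDisc) :
    areaEnergy W (fun z => h (φ z)) ≤ ENNReal.ofReal K * areaEnergy W h := by
  have hd : ∀ z ∈ uDisc, HasFDerivWithinAt φ
      (((1 : ℂ →L[ℂ] ℂ).smulRight (deriv φ z)).restrictScalars ℝ) uDisc z := fun z hz =>
    ((hφ.differentiableAt (isOpen_uDisc.mem_nhds hz)).hasDerivAt.hasFDerivAt.restrictScalars
      ℝ).hasFDerivWithinAt
  have hmD : MeasurableSet uDisc := measurableSet_ball
  calc _ ≤ ∫⁻ z in uDisc, ENNReal.ofReal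
        |(((1 : ℂ →L[ℂ] ℂ).smulRight (deriv φ z)).restrictScalars ℝ).det| *
          (ENNReal.ofReal K * (‖deriv h (φ z)‖ₑ ^ 2 * ENNReal.ofReal (W ‖φ z‖))) := by
        refine setLIntegral_mono' hmD fun z hz => ?_
        rw [deriv_comp_of_mapsTo hφ hm hh hz, abs_det_smulRight_restrictScalars, enorm_mul, mul_pow,
          ENNReal.ofReal_pow (norm_nonneg _), ofReal_norm]
        have h1 : ENNReal.ofReal (W ‖z‖) ≤ ENNReal.ofReal K * ENNReal.ofReal (W ‖φ z‖) := by
          rw [← ENNReal.ofReal_mul (by linarith)]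
          exact ENNReal.ofReal_le_ofReal (hβ.le_mul K _ _ hK (hφK z hz))
        calc _ ≤ ‖deriv h (φ z)‖ₑ ^ 2 * ‖deriv φ z‖ₑ ^ 2 *
              (ENNReal.ofReal K * ENNReal.ofReal (W ‖φ z‖)) := by gcongr
          _ = _ := by ring
    _ = ∫⁻ w in φ '' uDisc, ENNReal.ofReal K * (‖deriv h w‖ₑ ^ 2 * ENNReal.ofReal (W ‖w‖)) :=
        (lintegral_image_eq_lintegral_abs_det_fderiv_mul volume hmD hd hi
          (fun w => ENNReal.ofReal K * (‖deriv h w‖ₑ ^ 2 * ENNReal.ofReal (W ‖w‖)))).symm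
    _ ≤ ∫⁻ w in uDisc, ENNReal.ofReal K * (‖deriv h w‖ₑ ^ 2 * ENNReal.ofReal (W ‖w‖)) :=
        lintegral_mono_set hm.image_subset
    _ = _ := lintegral_const_mul' _ _ ENNReal.ofReal_ne_top

theorem IsAreaWeight.norm_sq_le (hβ : IsAreaWeight β W) {h : ℂ → ℂ} {f : WH2}
    (hf : ∀ z ∈ uDisc, wToFun β f z = h z) {E : ℝ} (hE : 0 ≤ E)
    (hhE : areaEnergy W h ≤ ENNReal.ofReal E) : ‖f‖ ^ 2 ≤ ‖h 0‖ ^ 2 + E := by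
  have hh : DifferentiableOn ℂ h uDisc :=
    (differentiableOn_wToFun hβ.one_le f).congr fun z hz => (hf z hz).symm
  obtain ⟨g, hg, hgE⟩ := hβ.exists_wToFun_eq hh hE hhE
  rwa [wToFun_injective hβ.one_le (f := f) (g := g) fun z hz => by rw [hf z hz, hg z hz]]

/-- Boundedness of composition operators on `H²(β)`. -/
theorem IsAreaWeight.exists_representsComp (hβ : IsAreaWeight β W)
    (hφ : DifferentiableOn ℂ φ uDisc) (hm : MapsTo φ uDisc uDisc) (hi : InjOn φ uDisc)
    {K : ℝ} (hK : 1 ≤ K) (hφK : ∀ z ∈ uDisc, 1 - ‖z‖ ^ 2 ≤ K * (1 - ‖φ z‖ ^ 2)) :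
    ∃ T : WH2 →L[ℂ] WH2, RepresentsComp β T φ ∧ ∀ f, ‖T f‖ ≤ (2 * K + 1) * ‖f‖ := by
  have key : ∀ f : WH2, ∃ g : WH2, (∀ z ∈ uDisc, wToFun β g z = wToFun β f (φ z)) ∧
      ‖g‖ ≤ (2 * K + 1) * ‖f‖ := by
    intro f
    have hf := differentiableOn_wToFun hβ.one_le f
    have hE : areaEnergy W (fun z => wToFun β f (φ z)) ≤
        ENNReal.ofReal (K * (π * ‖f‖ ^ 2)) := by
      refine (hβ.areaEnergy_comp_le hφ hm hi hK hφK hf).trans ?_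
      rw [ENNReal.ofReal_mul (by linarith)]
      gcongr
      exact hβ.areaEnergy_wToFun_le f
    obtain ⟨g, hg, hgE⟩ := hβ.exists_wToFun_eq (h := fun z => wToFun β f (φ z))
      (hf.comp hφ hm) (by positivity) hE
    refine ⟨g, hg, ?_⟩
    have h0 : ‖wToFun β f (φ 0)‖ ≤ 2 * K * ‖f‖ := by
      refine (norm_wToFun_le hβ.one_le f (hm zero_mem_uDisc)).trans ?_
      have h1 := hφK 0 zero_mem_uDisc
      have h2 := mem_uDisc.1 (hm zero_mem_uDisc)
      rw [norm_zero] at h1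
      gcongr
      rw [inv_le_iff_one_le_mul₀ (by linarith)]
      nlinarith [norm_nonneg (φ 0), mul_nonneg (by linarith : 0 ≤ K)
        (mul_nonneg (by linarith : 0 ≤ 1 - ‖φ 0‖) (by linarith : 0 ≤ 1 - ‖φ 0‖))]
    refine abs_le_of_sq_le_sq' ?_ (by positivity) |>.2
    have h3 : ‖wToFun β f (φ 0)‖ ^ 2 ≤ (2 * K * ‖f‖) ^ 2 := by gcongr
    have h4 : K * (π * ‖f‖ ^ 2) ≤ K * (4 * ‖f‖ ^ 2) := by
      gcongr
      exact Real.pi_le_four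
    nlinarith [sq_nonneg ‖f‖]
  choose S hS hSn using key
  let T : WH2 →ₗ[ℂ] WH2 :=
    { toFun := S
      map_add' := fun f g => wToFun_injective hβ.one_le fun z hz => by
        rw [wToFun_add hβ.one_le _ _ hz, hS _ z hz, hS _ z hz, hS _ z hz,
          wToFun_add hβ.one_le _ _ (hm hz)]
      map_smul' := fun c f => wToFun_injective hβ.one_le fun z hz => by
        rw [RingHom.id_apply, wToFun_smul hβ.one_le _ _ hz, hS _ z hz, hS _ z hz,
          wToFun_smul hβ.one_le _ _ (hm hz)] }
  exact ⟨T.mkContinuous (2 * K + 1) hSn, ⟨hφ, hm, hS⟩, hSn⟩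

end Composition

theorem ext_single {E : Type*} [NormedAddCommGroup E] [NormedSpace ℂ E] {S T : WH2 →L[ℂ] E}
    (h : ∀ n, S (lp.single 2 n (1 : ℂ)) = T (lp.single 2 n (1 : ℂ))) : S = T := by
  ext f
  have hf := lp.hasSum_single (by simp) f
  have h1 : ∀ n, (lp.single 2 n (f n) : WH2) = f n • lp.single 2 n (1 : ℂ) := by
    intro n
    rw [← lp.single_smul, smul_eq_mul, mul_one]
  have h2 := hf.mapL S
  have h3 := hf.mapL T
  refine h2.unique (h3.congr_fun fun n => ?_)
  simp only [h1, map_smul, h]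

/-- The operator on `ℓ²` with absolutely summable columns `a n`. -/
noncomputable def columnOp (a : ℕ → WH2) : WH2 →L[ℂ] WH2 :=
  ∑' n, (lp.evalCLM ℂ (fun _ : ℕ => ℂ) 2 n).smulRight (a n)

theorem columnOp_single {a : ℕ → WH2} (ha : Summable fun n => ‖a n‖) (n : ℕ) :
    columnOp a (lp.single 2 n (1 : ℂ)) = a n := by
  have hs : Summable fun n => (lp.evalCLM ℂ (fun _ : ℕ => ℂ) 2 n).smulRight (a n) := by
    refine Summable.of_norm_bounded ha fun n => ?_
    rw [ContinuousLinearMap.norm_smulRight_apply]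
    refine mul_le_of_le_one_left (norm_nonneg _)
      (ContinuousLinearMap.opNorm_le_bound _ zero_le_one fun f => ?_)
    rw [one_mul]
    exact lp.norm_apply_le_norm (by simp) f n
  rw [columnOp, ← ContinuousLinearMap.apply_apply (𝕜 := ℂ),
    (ContinuousLinearMap.apply ℂ WH2 _).map_tsum hs, tsum_eq_single n]
  · change (lp.single 2 n (1 : ℂ) : WH2) n • a n = a n
    simp
  · intro m hm
    change (lp.single 2 n (1 : ℂ) : WH2) m • a m = 0
    simp [Pi.single_eq_of_ne hm]

theorem isHilbertSchmidt_columnOp {a : ℕ → WH2} (ha : Summable fun n => ‖a n‖) :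
    IsHilbertSchmidt (columnOp a) := by
  simp only [IsHilbertSchmidt, columnOp_single ha]
  refine Summable.of_norm_bounded_eventually_nat ha ?_
  filter_upwards [ha.tendsto_atTop_zero.eventually (ge_mem_nhds (zero_lt_one))] with n hn
  rw [Real.norm_of_nonneg (by positivity), sq]
  exact mul_le_of_le_one_left (norm_nonneg _) hn

/-- An operator whose matrix has geometrically decaying columns is trace class. -/
theorem isTraceClass_of_summable {T : WH2 →L[ℂ] WH2} {s : ℝ} (hs0 : 0 < s) (hs1 : s < 1)
    (hT : Summable fun n => (s ^ n)⁻¹ * ‖T (lp.single 2 n (1 : ℂ))‖) : IsTraceClass T := by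
  let a : ℕ → WH2 := fun n => ((s : ℂ) ^ n)⁻¹ • T (lp.single 2 n (1 : ℂ))
  let b : ℕ → WH2 := fun n => (s : ℂ) ^ n • lp.single 2 n (1 : ℂ)
  have ha : Summable fun n => ‖a n‖ := by
    simpa [a, norm_smul, abs_of_pos hs0] using hT
  have hb : Summable fun n => ‖b n‖ := by
    simpa [b, norm_smul, abs_of_pos hs0, lp.norm_single] using
      summable_geometric_of_lt_one hs0.le hs1
  refine ⟨columnOp a, columnOp b, isHilbertSchmidt_columnOp ha, isHilbertSchmidt_columnOp hb,
    ext_single fun n => ?_⟩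
  have : (s : ℂ) ^ n ≠ 0 := by exact_mod_cast (pow_pos hs0 n).ne'
  rw [ContinuousLinearMap.comp_apply, columnOp_single hb, map_smul, columnOp_single ha,
    smul_smul, mul_inv_cancel₀ this, one_smul]

theorem IsAreaWeight.areaEnergy_le_of_norm_deriv_le {β : ℕ → ℝ} {W : ℝ → ℝ}
    (hβ : IsAreaWeight β W) {h : ℂ → ℂ} {B : ℝ} (hB : ∀ z ∈ uDisc, ‖deriv h z‖ ≤ B) :
    areaEnergy W h ≤ ENNReal.ofReal (π * B ^ 2) := by
  have hmD : MeasurableSet uDisc := measurableSet_ball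
  calc areaEnergy W h ≤ ∫⁻ _ in uDisc, ENNReal.ofReal (B ^ 2) := by
        refine setLIntegral_mono' hmD fun z hz => ?_
        have h0 : 0 ≤ B := (norm_nonneg _).trans (hB z hz)
        rw [← ofReal_norm, ← ENNReal.ofReal_pow (norm_nonneg _),
          ← ENNReal.ofReal_mul (by positivity)]
        refine ENNReal.ofReal_le_ofReal ?_
        have h1 : W ‖z‖ ≤ 1 := hβ.le_one _
        have h2 : ‖deriv h z‖ ^ 2 ≤ B ^ 2 := by gcongr; exact hB z hz
        nlinarith [sq_nonneg ‖deriv h z‖]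
    _ = ENNReal.ofReal (π * B ^ 2) := by
        rw [setLIntegral_const, uDisc, Complex.volume_ball, mul_comm π,
          ENNReal.ofReal_mul (sq_nonneg _)]
        rw [← NNReal.coe_real_pi, ENNReal.ofReal_coe_nnreal]
        simp

theorem IsAreaWeight.norm_le_of_norm_deriv_le {β : ℕ → ℝ} {W : ℝ → ℝ}
    (hβ : IsAreaWeight β W) {h : ℂ → ℂ} {f : WH2} (hf : ∀ z ∈ uDisc, wToFun β f z = h z)
    {A B : ℝ} (hA : ‖h 0‖ ≤ A) (hB : ∀ z ∈ uDisc, ‖deriv h z‖ ≤ B) : ‖f‖ ≤ A + 2 * B := by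
  have hB0 : 0 ≤ B := (norm_nonneg _).trans (hB 0 zero_mem_uDisc)
  have hA0 : 0 ≤ A := (norm_nonneg _).trans hA
  have h1 := hβ.norm_sq_le hf (by positivity) (hβ.areaEnergy_le_of_norm_deriv_le hB)
  refine (abs_le_of_sq_le_sq' ?_ (by positivity)).2
  have h2 : ‖h 0‖ ^ 2 ≤ A ^ 2 := by gcongr
  have h3 : π * B ^ 2 ≤ 4 * B ^ 2 := by
    gcongr
    exact Real.pi_le_four
  nlinarith [mul_nonneg hA0 hB0]

theorem eW_eq_smul (β : ℕ → ℝ) (n : ℕ) : eW β n = (β n : ℂ) • lp.single 2 n (1 : ℂ) := by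
  rw [eW, ← lp.single_smul, smul_eq_mul, mul_one]

theorem IsAreaWeight.isTraceClass_of_representsComp {β : ℕ → ℝ} {W : ℝ → ℝ}
    (hβ : IsAreaWeight β W) {T : WH2 →L[ℂ] WH2} {φ : ℂ → ℂ} (hT : RepresentsComp β T φ)
    {r L : ℝ} (hr0 : 0 < r) (hr1 : r < 1) (hr : ∀ z ∈ uDisc, ‖φ z‖ ≤ r)
    (hL : ∀ z ∈ uDisc, ‖deriv φ z‖ ≤ L) : IsTraceClass T := by
  have hL0 : 0 ≤ L := (norm_nonneg _).trans (hL 0 zero_mem_uDisc)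
  have hn : ∀ n : ℕ, ‖T (lp.single 2 n (1 : ℂ))‖ ≤ r ^ n + 2 * (n * r ^ (n - 1) * L) := by
    intro n
    have h1 : ‖T (eW β n)‖ ≤ r ^ n + 2 * (n * r ^ (n - 1) * L) := by
      refine hβ.norm_le_of_norm_deriv_le (h := fun z => φ z ^ n) (fun z hz => ?_) ?_
        fun z hz => ?_
      · rw [hT.2.2 _ z hz, wToFun_eW hβ.one_le]
      · rw [norm_pow]
        exact pow_le_pow_left₀ (norm_nonneg _) (hr 0 zero_mem_uDisc) n
      · rw [deriv_fun_pow (hT.1.differentiableAt (isOpen_uDisc.mem_nhds hz)), norm_mul, norm_mul,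
          norm_pow, Complex.norm_natCast]
        gcongr
        · exact hr z hz
        · exact hL z hz
    refine le_trans ?_ h1
    rw [eW_eq_smul, map_smul, norm_smul, Complex.norm_real, Real.norm_eq_abs]
    exact le_mul_of_one_le_left (norm_nonneg _) ((hβ.one_le n).trans (le_abs_self _))
  have hs0 : 0 < √r := Real.sqrt_pos.2 hr0
  have hs1 : √r < 1 := by rw [Real.sqrt_lt' one_pos]; simpa using hr1
  refine isTraceClass_of_summable hs0 hs1 (Summable.of_nonneg_of_le (fun n => by positivity)
    (f := fun n : ℕ => √r ^ n + 2 * L / r * ((n : ℝ) ^ 1 * √r ^ n)) (fun n => ?_) ?_)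
  · have h2 : r ^ n = √r ^ n * √r ^ n := by rw [← mul_pow, Real.mul_self_sqrt hr0.le]
    have h3 : (n : ℝ) * r ^ (n - 1) = n * r ^ n / r := by
      rcases n with _ | n
      · simp
      · rw [Nat.add_sub_cancel, pow_succ]
        field_simp
    calc _ ≤ (√r ^ n)⁻¹ * (r ^ n + 2 * (n * r ^ (n - 1) * L)) := by gcongr; exact hn n
      _ = _ := by
        rw [h3, h2]
        field_simp
  · refine (summable_geometric_of_lt_one hs0.le hs1).add (Summable.mul_left _ ?_)
    exact summable_pow_mul_geometric_of_norm_lt_one 1 (by rwa [Real.norm_of_nonneg hs0.le])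

theorem add_mul_sub_mem_uDisc {x y : ℂ} (hx : x ∈ uDisc) (hy : y ∈ uDisc) {s : ℝ}
    (hs : s ∈ Icc (0 : ℝ) 1) : y + s * (x - y) ∈ uDisc := by
  have := (convex_ball (0 : ℂ) 1).add_smul_sub_mem hy hx hs
  simpa [uDisc, Complex.real_smul] using this

theorem abs_re_sub_mul_conj_le {G : ℂ → ℂ} (hG : DifferentiableOn ℂ G uDisc) {M : ℝ}
    (hM : ∀ z ∈ uDisc, |(deriv G z).re| ≤ M) {x y : ℂ} (hx : x ∈ uDisc) (hy : y ∈ uDisc) :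
    |((starRingEnd ℂ) (x - y) * (G x - G y)).re| ≤ M * ‖x - y‖ ^ 2 := by
  let f : ℝ → ℝ := fun s => ((starRingEnd ℂ) (x - y) * G (y + s * (x - y))).re
  have hf : ∀ s ∈ Icc (0 : ℝ) 1,
      HasDerivAt f ((deriv G (y + s * (x - y))).re * ‖x - y‖ ^ 2) s := by
    intro s hs
    have h1 : HasDerivAt (fun s : ℝ => y + s * (x - y)) (x - y) s := by
      simpa using ((Complex.ofRealCLM.hasDerivAt (x := s)).mul_const (x - y)).const_add y
    have h2 := (hG.differentiableAt (isOpen_uDisc.mem_nhds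
      (add_mul_sub_mem_uDisc hx hy hs))).hasDerivAt.scomp_of_eq s h1 rfl
    have h3 := Complex.reCLM.hasFDerivAt.comp_hasDerivAt s
      (h2.const_mul ((starRingEnd ℂ) (x - y)))
    refine h3.congr_deriv ?_
    rw [Complex.reCLM_apply, smul_eq_mul, ← mul_assoc, Complex.conj_mul', ← Complex.ofReal_pow,
      Complex.re_ofReal_mul, mul_comm]
  have := norm_image_sub_le_of_norm_deriv_le_segment_01' (f := f) (C := M * ‖x - y‖ ^ 2)
    (fun s hs => (hf s hs).hasDerivWithinAt) fun s hs => by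
      rw [norm_mul, Real.norm_eq_abs, norm_pow, norm_norm]
      gcongr
      exact hM _ (add_mul_sub_mem_uDisc hx hy (Ico_subset_Icc_self hs))
  simpa [f, mul_sub] using this

theorem exp_mul_le_of_abs_deriv_le {N N' : ℝ → ℝ} {M : ℝ}
    (hN : ∀ s, 0 ≤ s → HasDerivAt N (N' s) s) (hM : ∀ s, 0 ≤ s → |N' s| ≤ M * N s) {t : ℝ}
    (ht : 0 ≤ t) : Real.exp (-(M * t)) * N 0 ≤ N t ∧ N t ≤ Real.exp (M * t) * N 0 := by
  have hd : ∀ c s, 0 ≤ s → HasDerivAt (fun s => Real.exp (c * s) * N s)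
      (Real.exp (c * s) * (c * N s + N' s)) s := by
    intro c s hs
    have h1 : HasDerivAt (fun s => Real.exp (c * s)) (Real.exp (c * s) * c) s := by
      simpa using ((hasDerivAt_id s).const_mul c).exp
    refine (h1.mul (hN s hs)).congr_deriv ?_
    ring
  have hc : ∀ c, ContinuousOn (fun s => Real.exp (c * s) * N s) (Ici 0) := fun c s hs =>
    (hd c s hs).continuousAt.continuousWithinAt
  have hi : ∀ s ∈ interior (Ici (0 : ℝ)), 0 ≤ s := fun s hs => (interior_subset hs : s ∈ Ici 0)
  have hdi : ∀ c, DifferentiableOn ℝ (fun s => Real.exp (c * s) * N s) (interior (Ici 0)) :=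
    fun c s hs => (hd c s (hi s hs)).differentiableAt.differentiableWithinAt
  have h1 := antitoneOn_of_deriv_nonpos (convex_Ici 0) (hc (-M)) (hdi (-M)) (fun s hs => by
    rw [(hd _ s (hi s hs)).deriv]
    refine mul_nonpos_of_nonneg_of_nonpos (Real.exp_pos _).le ?_
    linarith [(abs_le.1 (hM s (hi s hs))).2]) (mem_Ici.2 le_rfl) (mem_Ici.2 ht) ht
  have h2 := monotoneOn_of_deriv_nonneg (convex_Ici 0) (hc M) (hdi M) (fun s hs => by
    rw [(hd _ s (hi s hs)).deriv]
    refine mul_nonneg (Real.exp_pos _).le ?_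
    linarith [(abs_le.1 (hM s (hi s hs))).1]) (mem_Ici.2 le_rfl) (mem_Ici.2 ht) ht
  simp only [mul_zero, Real.exp_zero, one_mul, neg_mul] at h1 h2
  constructor
  · rw [Real.exp_neg]
    rwa [inv_mul_le_iff₀ (Real.exp_pos _)]
  · rwa [Real.exp_neg, inv_mul_le_iff₀ (Real.exp_pos _)] at h1

section Flow

variable {G : ℂ → ℂ} {φ : ℝ → ℂ → ℂ} {M : ℝ}

theorem IsSemiflow.mem (hφ : IsSemiflow φ) {t : ℝ} (ht : 0 ≤ t) {z : ℂ} (hz : z ∈ uDisc) :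
    φ t z ∈ uDisc := (hφ.2.1 t ht).2 hz

theorem IsSemiflow.norm_sub_sq_bounds (hφ : IsSemiflow φ) (hgen : SemiflowGenerator φ G)
    (hG : DifferentiableOn ℂ G uDisc) (hM : ∀ z ∈ uDisc, |(deriv G z).re| ≤ M)
    {t : ℝ} (ht : 0 ≤ t) {z w : ℂ} (hz : z ∈ uDisc) (hw : w ∈ uDisc) :
    Real.exp (-(2 * M * t)) * ‖z - w‖ ^ 2 ≤ ‖φ t z - φ t w‖ ^ 2 ∧
      ‖φ t z - φ t w‖ ^ 2 ≤ Real.exp (2 * M * t) * ‖z - w‖ ^ 2 := by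
  have := exp_mul_le_of_abs_deriv_le (M := 2 * M) (N := fun s => ‖φ s z - φ s w‖ ^ 2)
    (fun s hs => ((hgen z hz s hs).sub (hgen w hw s hs)).norm_sq) (fun s hs => by
      have h := abs_re_sub_mul_conj_le hG hM (hφ.mem hs hz) (hφ.mem hs hw)
      rw [abs_mul, abs_two, mul_assoc]
      gcongr
      simpa [Complex.inner, mul_comm] using h) ht
  simpa only [hφ.1 z hz, hφ.1 w hw] using this

theorem IsSemiflow.injOn (hφ : IsSemiflow φ) (hgen : SemiflowGenerator φ G)
    (hG : DifferentiableOn ℂ G uDisc) (hM : ∀ z ∈ uDisc, |(deriv G z).re| ≤ M)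
    {t : ℝ} (ht : 0 ≤ t) : InjOn (φ t) uDisc := by
  intro z hz w hw h
  have h1 := (hφ.norm_sub_sq_bounds hgen hG hM ht hz hw).1
  rw [h, sub_self, norm_zero] at h1
  have h2 : ‖z - w‖ ^ 2 ≤ 0 := by
    by_contra! h3
    have := mul_pos (Real.exp_pos (-(2 * M * t))) h3
    norm_num at h1
    linarith
  have h3 : ‖z - w‖ = 0 := by nlinarith [norm_nonneg (z - w)]
  rwa [norm_eq_zero, sub_eq_zero] at h3

theorem IsSemiflow.norm_deriv_le (hφ : IsSemiflow φ) (hgen : SemiflowGenerator φ G)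
    (hG : DifferentiableOn ℂ G uDisc) (hM : ∀ z ∈ uDisc, |(deriv G z).re| ≤ M)
    {t : ℝ} (ht : 0 ≤ t) {z : ℂ} (hz : z ∈ uDisc) : ‖deriv (φ t) z‖ ≤ Real.exp (M * t) := by
  refine norm_deriv_le_of_lip' (Real.exp_pos _).le ?_
  filter_upwards [isOpen_uDisc.mem_nhds hz] with w hw
  have h := (hφ.norm_sub_sq_bounds hgen hG hM ht hw hz).2
  refine (abs_le_of_sq_le_sq' ?_ (by positivity)).2
  rwa [mul_pow, ← Real.exp_nat_mul, Nat.cast_two, ← mul_assoc]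

end Flow

theorem norm_deriv_deriv_le {G : ℂ → ℂ} (hG : DifferentiableOn ℂ G uDisc) {M : ℝ}
    (hM : ∀ z ∈ uDisc, |(deriv G z).re| ≤ M) {z : ℂ} (hz : z ∈ uDisc) :
    ‖deriv (deriv G) z‖ ≤ 2 * Real.exp (2 * M) / (1 - ‖z‖) := by
  have hz1 : 0 < 1 - ‖z‖ := sub_pos.2 (mem_uDisc.1 hz)
  have hd : DifferentiableOn ℂ (deriv G) uDisc := hG.deriv isOpen_uDisc
  have hsub : closedBall z ((1 - ‖z‖) / 2) ⊆ uDisc := by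
    intro w hw
    rw [mem_uDisc]
    have h1 := norm_le_norm_add_norm_sub' w z
    have h2 : ‖w - z‖ ≤ (1 - ‖z‖) / 2 := mem_closedBall_iff_norm.1 hw
    linarith
  have h1 : ‖deriv (fun w => Complex.exp (deriv G w)) z‖ ≤ Real.exp M / ((1 - ‖z‖) / 2) := by
    refine Complex.norm_deriv_le_of_forall_mem_sphere_norm_le (by linarith)
      (((hd.mono hsub).cexp).diffContOnCl_ball le_rfl) fun w hw => ?_
    rw [Complex.norm_exp]
    exact Real.exp_le_exp.2 ((le_abs_self _).trans (hM w (hsub (sphere_subset_closedBall hw))))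
  have h2 : deriv (fun w => Complex.exp (deriv G w)) z =
      Complex.exp (deriv G z) * deriv (deriv G) z :=
    (hd.differentiableAt (isOpen_uDisc.mem_nhds hz)).hasDerivAt.cexp.deriv
  rw [h2, norm_mul, Complex.norm_exp] at h1
  have h3 : Real.exp (-M) ≤ Real.exp (deriv G z).re :=
    Real.exp_le_exp.2 (abs_le.1 (hM z hz)).1
  have h4 : Real.exp (-M) * ‖deriv (deriv G) z‖ ≤ Real.exp M / ((1 - ‖z‖) / 2) :=
    (by gcongr : _ ≤ _).trans h1
  rw [Real.exp_neg, inv_mul_le_iff₀ (Real.exp_pos _)] at h4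
  refine h4.trans (le_of_eq ?_)
  rw [two_mul M, Real.exp_add]
  field_simp

theorem norm_sub_le_sub_of_norm_deriv_le {E : Type*} [NormedAddCommGroup E] [NormedSpace ℝ E]
    {f f' : ℝ → E} {B B' : ℝ → ℝ} {a b : ℝ} (hf : ∀ x ∈ Icc a b, HasDerivAt f (f' x) x)
    (hB : ∀ x ∈ Icc a b, HasDerivAt B (B' x) x) (h : ∀ x ∈ Icc a b, ‖f' x‖ ≤ B' x)
    (hab : a ≤ b) : ‖f b - f a‖ ≤ B b - B a :=
  image_norm_le_of_norm_deriv_right_le_deriv_boundary' (f := fun x => f x - f a)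
    (B := fun x => B x - B a)
    (fun x hx => ((hf x hx).sub_const _).continuousAt.continuousWithinAt)
    (fun x hx => ((hf x (Ico_subset_Icc_self hx)).sub_const _).hasDerivWithinAt)
    (by simp)
    (fun x hx => ((hB x hx).sub_const _).continuousAt.continuousWithinAt)
    (fun x hx => ((hB x (Ico_subset_Icc_self hx)).sub_const _).hasDerivWithinAt)
    (fun x hx => h x (Ico_subset_Icc_self hx)) (right_mem_Icc.2 hab)

theorem ofReal_mul_mem_uDisc {ω : ℂ} (hω : ‖ω‖ = 1) {r : ℝ} (hr0 : 0 ≤ r) (hr1 : r < 1) :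
    (r : ℂ) * ω ∈ uDisc := by
  rwa [mem_uDisc, norm_mul, hω, mul_one, Complex.norm_real, Real.norm_of_nonneg hr0]

theorem hasDerivAt_comp_radius {h : ℂ → ℂ} (hh : DifferentiableOn ℂ h uDisc) {ω : ℂ}
    (hω : ‖ω‖ = 1) {r : ℝ} (hr0 : 0 ≤ r) (hr1 : r < 1) :
    HasDerivAt (fun r : ℝ => h (r * ω)) (ω * deriv h (r * ω)) r := by
  have h1 : HasDerivAt (fun r : ℝ => (r : ℂ) * ω) ω r := by
    simpa using (Complex.ofRealCLM.hasDerivAt (x := r)).mul_const ω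
  exact (hh.differentiableAt (isOpen_uDisc.mem_nhds
    (ofReal_mul_mem_uDisc hω hr0 hr1))).hasDerivAt.scomp_of_eq r h1 rfl

theorem norm_deriv_radius_le {G : ℂ → ℂ} (hG : DifferentiableOn ℂ G uDisc) {M : ℝ}
    (hM : ∀ z ∈ uDisc, |(deriv G z).re| ≤ M) {ω : ℂ} (hω : ‖ω‖ = 1) {r : ℝ} (hr0 : 0 ≤ r)
    (hr1 : r < 1) :
    ‖deriv G (r * ω)‖ ≤ ‖deriv G 0‖ - 2 * Real.exp (2 * M) * Real.log (1 - r) := by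
  have h := norm_sub_le_sub_of_norm_deriv_le (a := 0) (b := r)
    (f := fun s : ℝ => deriv G (s * ω)) (B := fun s => -(2 * Real.exp (2 * M) * Real.log (1 - s)))
    (B' := fun s => 2 * Real.exp (2 * M) / (1 - s))
    (fun s hs => hasDerivAt_comp_radius (hG.deriv isOpen_uDisc) hω hs.1 (hs.2.trans_lt hr1))
    (fun s hs => by
      refine (((((hasDerivAt_id s).const_sub 1).log
        (by have := hs.2; simp only [id]; linarith)).const_mul _).neg).congr_deriv ?_
      simp only [id]
      ring)
    (fun s hs => by
      have hs1 := hs.2.trans_lt hr1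
      rw [norm_mul, hω, one_mul]
      refine (norm_deriv_deriv_le hG hM (ofReal_mul_mem_uDisc hω hs.1 hs1)).trans_eq ?_
      rw [norm_mul, hω, mul_one, Complex.norm_real, Real.norm_of_nonneg hs.1]) hr0
  simp only [Complex.ofReal_zero, zero_mul, sub_zero, Real.log_one, mul_zero, neg_zero] at h
  have := norm_le_norm_add_norm_sub' (deriv G (r * ω)) (deriv G 0)
  linarith

/-- If `Re G'` is bounded then `G` has radial limits at every point of the circle. -/
theorem exists_tendsto_radius {G : ℂ → ℂ} (hG : DifferentiableOn ℂ G uDisc) {M : ℝ}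
    (hM : ∀ z ∈ uDisc, |(deriv G z).re| ≤ M) {ω : ℂ} (hω : ‖ω‖ = 1) :
    ∃ L, Tendsto (fun r : ℝ => G (r * ω)) (𝓝[<] 1) (𝓝 L) := by
  set C := ‖deriv G 0‖
  set K := 2 * Real.exp (2 * M)
  let B : ℝ → ℝ := fun r => C * r + K * (r - Real.negMulLog (1 - r))
  have hB : ∀ s < 1, HasDerivAt B (C - K * Real.log (1 - s)) s := by
    intro s hs
    have h1 := (Real.hasDerivAt_negMulLog (sub_pos.2 hs).ne').comp_const_sub 1 s
    refine (((hasDerivAt_id s).const_mul C).add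
      (((hasDerivAt_id s).sub h1).const_mul K)).congr_deriv ?_
    ring
  have hBc : Continuous B := by
    have := Real.continuous_negMulLog
    fun_prop
  have key : ∀ s r : ℝ, 0 ≤ s → s ≤ r → r < 1 →
      ‖G (r * ω) - G (s * ω)‖ ≤ B r - B s := fun s r hs0 hsr hr1 =>
    norm_sub_le_sub_of_norm_deriv_le (f := fun s : ℝ => G (s * ω))
      (fun x hx => hasDerivAt_comp_radius hG hω (hs0.trans hx.1) (hx.2.trans_lt hr1))
      (fun x hx => hB x (hx.2.trans_lt hr1))
      (fun x hx => by
        rw [norm_mul, hω, one_mul]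
        exact norm_deriv_radius_le hG hM hω (hs0.trans hx.1) (hx.2.trans_lt hr1)) hsr
  have key' : ∀ s ∈ Ioo (0 : ℝ) 1, ∀ r ∈ Ioo (0 : ℝ) 1,
      dist (G (s * ω)) (G (r * ω)) ≤ dist (B s) (B r) := by
    intro s hs r hr
    rcases le_total s r with h | h
    · rw [dist_comm, dist_comm (B s), dist_eq_norm, Real.dist_eq]
      exact (key s r hs.1.le h hr.2).trans (le_abs_self _)
    · rw [dist_eq_norm, Real.dist_eq]
      exact (key r s hr.1.le h hs.2).trans (le_abs_self _)
  have hlim : Tendsto B (𝓝[<] 1) (𝓝 (B 1)) := hBc.continuousAt.tendsto.mono_left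
    nhdsWithin_le_nhds
  have hmem : ∀ᶠ s : ℝ in 𝓝[<] 1, s ∈ Ioo (0 : ℝ) 1 := Ioo_mem_nhdsLT one_pos
  refine cauchy_map_iff_exists_tendsto.1 (cauchy_map_iff.2 ⟨inferInstance, ?_⟩)
  rw [tendsto_uniformity_iff_dist_tendsto_zero]
  have h0 : Tendsto (fun p : ℝ × ℝ => dist (B p.1) (B p.2)) (𝓝[<] 1 ×ˢ 𝓝[<] 1) (𝓝 0) := by
    simpa using (hlim.comp tendsto_fst).dist (hlim.comp tendsto_snd)
  refine squeeze_zero' (Eventually.of_forall fun _ => dist_nonneg) ?_ h0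
  filter_upwards [hmem.prod_mk hmem] with p hp
  exact key' _ hp.1 _ hp.2

theorem re_conj_mul_le_of_boundary {G : ℂ → ℂ} (hG : DifferentiableOn ℂ G uDisc) {M η : ℝ}
    (hM : ∀ z ∈ uDisc, |(deriv G z).re| ≤ M) (hb : BoundaryReLe G 0 (-η)) (θ : ℝ) {r : ℝ}
    (hr0 : 0 ≤ r) (hr1 : r < 1) :
    ((starRingEnd ℂ) (Complex.exp (θ * I)) * G (r * Complex.exp (θ * I))).re ≤
      -η + M * (1 - r) := by
  have hae : ∀ᵐ t : ℝ,
      ((starRingEnd ℂ) (Complex.exp (t * I)) * G (r * Complex.exp (t * I))).re ≤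
        -η + M * (1 - r) := by
    filter_upwards [hb] with t ht
    have hω : ‖Complex.exp (t * I)‖ = 1 := Complex.norm_exp_ofReal_mul_I t
    set ω := Complex.exp (t * I)
    obtain ⟨L, hL⟩ := exists_tendsto_radius hG hM hω
    have h1 := ht L hL
    simp only [Complex.ofReal_zero, zero_mul, Complex.exp_zero, one_mul] at h1
    have h2 : Tendsto (fun s : ℝ => ((starRingEnd ℂ) ω * G (s * ω)).re + M * (s - r)) (𝓝[<] 1)
        (𝓝 (((starRingEnd ℂ) ω * L).re + M * (1 - r))) := by
      refine (Complex.continuous_re.continuousAt.tendsto.comp (hL.const_mul _)).add ?_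
      exact (Continuous.tendsto (by fun_prop) 1).mono_left nhdsWithin_le_nhds
    refine le_trans (ge_of_tendsto h2 ?_) (by linarith)
    filter_upwards [Ioo_mem_nhdsLT hr1] with s hs
    have h3 := abs_re_sub_mul_conj_le hG hM (ofReal_mul_mem_uDisc hω hr0 hr1)
      (ofReal_mul_mem_uDisc hω (hr0.trans hs.1.le) hs.2)
    have h4 : (starRingEnd ℂ) (r * ω - s * ω) * (G (r * ω) - G (s * ω)) =
        ((r - s : ℝ) : ℂ) * ((starRingEnd ℂ) ω * G (r * ω) - (starRingEnd ℂ) ω * G (s * ω)) := by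
      rw [← sub_mul, map_mul, ← Complex.ofReal_sub, Complex.conj_ofReal]
      ring
    rw [h4, Complex.re_ofReal_mul, ← sub_mul, norm_mul, hω, mul_one, ← Complex.ofReal_sub,
      Complex.norm_real, Real.norm_eq_abs, sq_abs, Complex.sub_re] at h3
    have h5 := (abs_le.1 h3).1
    have h6 : 0 < s - r := sub_pos.2 hs.1
    by_contra! h7
    nlinarith
  have hd := Measure.dense_of_ae hae
  have hc : IsClosed {t : ℝ |
      ((starRingEnd ℂ) (Complex.exp (t * I)) * G (r * Complex.exp (t * I))).re ≤
        -η + M * (1 - r)} := by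
    have hcG : Continuous fun t : ℝ => G (r * Complex.exp (t * I)) :=
      hG.continuousOn.comp_continuous (by fun_prop) fun t =>
        ofReal_mul_mem_uDisc (Complex.norm_exp_ofReal_mul_I t) hr0 hr1
    refine isClosed_le (Complex.continuous_re.comp (Continuous.mul ?_ hcG)) continuous_const
    exact Complex.continuous_conj.comp (by fun_prop)
  exact hc.closure_subset (hd θ)

/-- Near the boundary, the field `G` points strictly into the disc. -/
theorem exists_re_conj_mul_le {G : ℂ → ℂ} (hG : DifferentiableOn ℂ G uDisc) {M η : ℝ}
    (hM : ∀ z ∈ uDisc, |(deriv G z).re| ≤ M) (hη : 0 < η) (hb : BoundaryReLe G 0 (-η)) :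
    ∃ ρ ∈ Ioo (0 : ℝ) 1, ∃ c > 0, ∀ z ∈ uDisc, ρ ≤ ‖z‖ →
      ((starRingEnd ℂ) z * G z).re ≤ -c := by
  have hM0 : 0 ≤ M := (abs_nonneg _).trans (hM 0 zero_mem_uDisc)
  have hq : 0 < η / (2 * (M + 1)) := by positivity
  refine ⟨max (1 / 2) (1 - η / (2 * (M + 1))), ⟨by positivity, max_lt (by norm_num) (by linarith)⟩,
    η / 4, by positivity, fun z hz hρ => ?_⟩
  have h1 := re_conj_mul_le_of_boundary hG hM hb (arg z) (norm_nonneg z) (mem_uDisc.1 hz)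
  rw [Complex.norm_mul_exp_arg_mul_I] at h1
  have h2 : M * (1 - ‖z‖) ≤ η / 2 := by
    have h3 : 1 - ‖z‖ ≤ η / (2 * (M + 1)) := by linarith [(le_max_right _ _).trans hρ]
    calc M * (1 - ‖z‖) ≤ (M + 1) * (η / (2 * (M + 1))) := by
          have : 0 ≤ η / (2 * (M + 1)) := hq.le
          nlinarith [mem_uDisc.1 hz]
      _ = η / 2 := by field_simp
  have h4 : (starRingEnd ℂ) z * G z =
      (‖z‖ : ℂ) * ((starRingEnd ℂ) (Complex.exp (arg z * I)) * G z) := by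
    conv_lhs => rw [← Complex.norm_mul_exp_arg_mul_I z, map_mul, Complex.conj_ofReal]
    rw [Complex.norm_mul_exp_arg_mul_I, mul_assoc]
  rw [h4, Complex.re_ofReal_mul]
  have h5 : 1 / 2 ≤ ‖z‖ := (le_max_left _ _).trans hρ
  nlinarith

section Flow

variable {G : ℂ → ℂ} {φ : ℝ → ℂ → ℂ} {ρ c : ℝ}

theorem IsSemiflow.norm_sq_le_sub (hφ : IsSemiflow φ) (hgen : SemiflowGenerator φ G)
    (hρ : 0 < ρ) (hc : 0 < c)
    (hG : ∀ z ∈ uDisc, ρ ≤ ‖z‖ → ((starRingEnd ℂ) z * G z).re ≤ -c) {t : ℝ} (ht : 0 ≤ t)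
    {z : ℂ} (hz : z ∈ uDisc) {b ε : ℝ} (hb : ‖z‖ ^ 2 ≤ b) (hε0 : 0 ≤ ε) (hεc : ε ≤ c)
    (hbt : ρ ^ 2 ≤ b - ε * t) : ‖φ t z‖ ^ 2 ≤ b - ε * t := by
  have hv : ∀ s, 0 ≤ s → HasDerivAt (fun s => ‖φ s z‖ ^ 2)
      (2 * ((starRingEnd ℂ) (φ s z) * G (φ s z)).re) s := by
    intro s hs
    have := (hgen z hz s hs).norm_sq
    rwa [Complex.inner, mul_comm (G _)] at this
  refine image_le_of_deriv_right_lt_deriv_boundary (f := fun s => ‖φ s z‖ ^ 2) (a := 0) (b := t)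
    (B := fun s => b - ε * s) (B' := fun _ => -ε)
    (fun s hs => (hv s hs.1).continuousAt.continuousWithinAt)
    (fun s hs => (hv s hs.1).hasDerivWithinAt) (by simpa [hφ.1 z hz] using hb)
    (fun s => by simpa using ((hasDerivAt_id s).const_mul ε).const_sub b)
    (fun s hs h => ?_) (right_mem_Icc.2 ht)
  have h1 : ρ ^ 2 ≤ ‖φ s z‖ ^ 2 := by
    have := mul_le_mul_of_nonneg_left hs.2.le hε0
    linarith
  have h2 := hG _ (hφ.mem hs.1 hz) ((pow_le_pow_iff_left₀ hρ.le (norm_nonneg _) two_ne_zero).1 h1)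
  linarith

theorem IsSemiflow.one_sub_norm_sq_le (hφ : IsSemiflow φ) (hgen : SemiflowGenerator φ G)
    (hρ : ρ ∈ Ioo (0 : ℝ) 1) (hc : 0 < c)
    (hG : ∀ z ∈ uDisc, ρ ≤ ‖z‖ → ((starRingEnd ℂ) z * G z).re ≤ -c) {t : ℝ} (ht : 0 ≤ t)
    {z : ℂ} (hz : z ∈ uDisc) : 1 - ‖z‖ ^ 2 ≤ 2 / (1 - ρ ^ 2) * (1 - ‖φ t z‖ ^ 2) := by
  have hρ1 : 0 < 1 - ρ ^ 2 := by nlinarith [hρ.1, hρ.2]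
  have h1 := hφ.norm_sq_le_sub hgen hρ.1 hc hG ht hz (le_max_left _ ((1 + ρ ^ 2) / 2)) le_rfl hc.le
    (by have := le_max_right (‖z‖ ^ 2) ((1 + ρ ^ 2) / 2); linarith)
  rw [div_mul_eq_mul_div, le_div_iff₀ hρ1]
  have h2 : ‖z‖ ^ 2 ≤ 1 := pow_le_one₀ (norm_nonneg _) (mem_uDisc.1 hz).le
  rcases le_total (‖z‖ ^ 2) ((1 + ρ ^ 2) / 2) with h | h
  · rw [max_eq_right h] at h1
    nlinarith [sq_nonneg ‖z‖]
  · rw [max_eq_left h] at h1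
    nlinarith [sq_nonneg ρ]

theorem IsSemiflow.exists_norm_le (hφ : IsSemiflow φ) (hgen : SemiflowGenerator φ G)
    (hρ : ρ ∈ Ioo (0 : ℝ) 1) (hc : 0 < c)
    (hG : ∀ z ∈ uDisc, ρ ≤ ‖z‖ → ((starRingEnd ℂ) z * G z).re ≤ -c) {t : ℝ} (ht : 0 < t) :
    ∃ r, 0 < r ∧ r < 1 ∧ ∀ z ∈ uDisc, ‖φ t z‖ ≤ r := by
  have hρ1 : 0 < 1 - ρ ^ 2 := by nlinarith [hρ.1, hρ.2]
  have hε : 0 < min c ((1 - ρ ^ 2) / (2 * t)) := lt_min hc (by positivity)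
  have hεt : min c ((1 - ρ ^ 2) / (2 * t)) * t ≤ (1 - ρ ^ 2) / 2 := by
    refine (mul_le_mul_of_nonneg_right (min_le_right _ _) ht.le).trans_eq ?_
    field_simp
  set ε := min c ((1 - ρ ^ 2) / (2 * t))
  have hεt0 : 0 < ε * t := mul_pos hε ht
  have h1 : 0 < 1 - ε * t := by nlinarith [sq_nonneg ρ]
  refine ⟨√(1 - ε * t), Real.sqrt_pos.2 h1, ?_, fun z hz => ?_⟩
  · rw [Real.sqrt_lt' one_pos]
    linarith
  · refine Real.le_sqrt_of_sq_le (hφ.norm_sq_le_sub hgen hρ.1 hc hG ht.le hz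
      (pow_le_one₀ (norm_nonneg _) (mem_uDisc.1 hz).le) hε.le (min_le_left _ _) (by linarith))

end Flow

section Flow

variable {β : ℕ → ℝ} {W : ℝ → ℝ} {φ : ℝ → ℂ → ℂ}

theorem IsSemiflow.tendstoLocallyUniformlyOn (hφ : IsSemiflow φ) :
    TendstoLocallyUniformlyOn φ (φ 0) (𝓝[≥] 0) uDisc := by
  rw [tendstoLocallyUniformlyOn_iff_forall_isCompact isOpen_uDisc]
  intro k hk hkc u hu
  obtain ⟨v, hv, hvu⟩ := hkc.mem_uniformity_of_prod (f := φ) (s := Ici 0) (q := 0)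
    (hφ.2.2.2.mono (prod_mono_right hk)) (mem_Ici.2 le_rfl) (symm_le_uniformity hu)
  filter_upwards [hv] with t ht z hz using hvu t ht z hz

theorem IsSemiflow.tendsto_deriv (hφ : IsSemiflow φ) {z : ℂ} (hz : z ∈ uDisc) :
    Tendsto (fun t => deriv (φ t) z) (𝓝[≥] 0) (𝓝 1) := by
  have h1 := (hφ.tendstoLocallyUniformlyOn.deriv (eventually_mem_nhdsWithin.mono fun t ht =>
    (hφ.2.1 t ht).1) isOpen_uDisc).tendsto_at hz
  have h2 : φ 0 =ᶠ[𝓝 z] id := by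
    filter_upwards [isOpen_uDisc.mem_nhds hz] with w hw using hφ.1 w hw
  rw [h2.deriv_eq, deriv_id] at h1
  exact h1

theorem IsSemiflow.tendsto (hφ : IsSemiflow φ) {z : ℂ} (hz : z ∈ uDisc) :
    Tendsto (fun t => φ t z) (𝓝[≥] 0) (𝓝 z) := by
  have h1 := hφ.tendstoLocallyUniformlyOn.tendsto_at hz
  rwa [hφ.1 z hz] at h1

theorem deriv_pow_sub_pow {ψ : ℂ → ℂ} (hψ : DifferentiableOn ℂ ψ uDisc) (n : ℕ) {z : ℂ}
    (hz : z ∈ uDisc) : deriv (fun z => ψ z ^ n - z ^ n) z =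
      n * ψ z ^ (n - 1) * deriv ψ z - n * z ^ (n - 1) := by
  have h := ((hψ.differentiableAt (isOpen_uDisc.mem_nhds hz)).hasDerivAt.fun_pow n).sub
    (hasDerivAt_pow n z)
  exact h.deriv

theorem IsAreaWeight.tendsto_areaEnergy_pow_sub (hβ : IsAreaWeight β W) (hφ : IsSemiflow φ)
    {L : ℝ} (hL : ∀ t ∈ Icc (0 : ℝ) 1, ∀ z ∈ uDisc, ‖deriv (φ t) z‖ ≤ L) (n : ℕ) :
    Tendsto (fun t => areaEnergy W fun z => φ t z ^ n - z ^ n) (𝓝[≥] 0) (𝓝 0) := by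
  have hmD : MeasurableSet uDisc := measurableSet_ball
  have hIcc : ∀ᶠ t : ℝ in 𝓝[≥] 0, t ∈ Icc (0 : ℝ) 1 := Icc_mem_nhdsGE one_pos
  have h0 : (0 : ℝ≥0∞) = ∫⁻ _ in uDisc, 0 := by simp
  rw [h0]
  refine tendsto_lintegral_filter_of_dominated_convergence'
    (fun _ => ENNReal.ofReal ((n * L + n) ^ 2)) ?_ ?_ ?_ ?_
  · filter_upwards [hIcc] with t ht
    have hd : DifferentiableOn ℂ (fun z => φ t z ^ n - z ^ n) uDisc :=
      ((hφ.2.1 t ht.1).1.pow n).sub (differentiableOn_id.pow n)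
    have h1 : AEMeasurable (deriv fun z => φ t z ^ n - z ^ n) (volume.restrict uDisc) :=
      (hd.deriv isOpen_uDisc).continuousOn.aemeasurable hmD
    have h2 : Measurable fun z : ℂ => ENNReal.ofReal (W ‖z‖) :=
      (hβ.cont.measurable.comp measurable_norm).ennreal_ofReal
    exact (h1.enorm.pow_const 2).mul h2.aemeasurable
  · filter_upwards [hIcc] with t ht
    filter_upwards [ae_restrict_mem hmD] with z hz
    have h1 : ENNReal.ofReal (W ‖z‖) ≤ 1 := by
      rw [← ENNReal.ofReal_one]
      exact ENNReal.ofReal_le_ofReal (hβ.le_one _)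
    refine (mul_le_of_le_one_right zero_le h1).trans ?_
    rw [← ofReal_norm, ← ENNReal.ofReal_pow (norm_nonneg _)]
    refine ENNReal.ofReal_le_ofReal (pow_le_pow_left₀ (norm_nonneg _) ?_ 2)
    rw [deriv_pow_sub_pow (hφ.2.1 t ht.1).1 n hz]
    refine (norm_sub_le _ _).trans ?_
    rw [norm_mul, norm_mul, norm_mul, norm_pow, norm_pow, Complex.norm_natCast]
    have h2 : ‖φ t z‖ ^ (n - 1) ≤ 1 :=
      pow_le_one₀ (norm_nonneg _) (mem_uDisc.1 (hφ.mem ht.1 hz)).le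
    have h3 : ‖z‖ ^ (n - 1) ≤ 1 := pow_le_one₀ (norm_nonneg _) (mem_uDisc.1 hz).le
    have h4 := hL t ht z hz
    calc _ ≤ n * 1 * L + n * 1 := by gcongr
      _ = _ := by ring
  · rw [setLIntegral_const]
    exact ENNReal.mul_ne_top ENNReal.ofReal_ne_top measure_ball_lt_top.ne
  · filter_upwards [ae_restrict_mem hmD] with z hz
    have h1 : Tendsto (fun t => deriv (fun z => φ t z ^ n - z ^ n) z) (𝓝[≥] 0) (𝓝 0) := by
      have h2 := ((((hφ.tendsto hz).pow (n - 1)).const_mul (n : ℂ)).mul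
        (hφ.tendsto_deriv hz)).sub_const (n * z ^ (n - 1))
      rw [mul_one, sub_self] at h2
      refine h2.congr' ?_
      filter_upwards [eventually_mem_nhdsWithin] with t ht
      rw [deriv_pow_sub_pow (hφ.2.1 t ht).1 n hz]
    have h3 : Tendsto (fun t => ‖deriv (fun z => φ t z ^ n - z ^ n) z‖ₑ ^ 2)
        (𝓝[≥] 0) (𝓝 0) := by
      simpa using ENNReal.Tendsto.pow (n := 2) h1.enorm
    simpa using ENNReal.Tendsto.mul_const h3 (Or.inr ENNReal.ofReal_ne_top)

end Flow

theorem tendsto_apply_of_tendsto_single {ι : Type*} {l : Filter ι} {S : ι → WH2 →L[ℂ] WH2} {C : ℝ}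
    (hC : ∀ᶠ i in l, ∀ f, ‖S i f‖ ≤ C * ‖f‖)
    (h : ∀ n, Tendsto (fun i => S i (lp.single 2 n (1 : ℂ))) l (𝓝 (lp.single 2 n (1 : ℂ))))
    (f : WH2) : Tendsto (fun i => S i f) l (𝓝 f) := by
  rw [Metric.tendsto_nhds]
  intro ε hε
  have hδ : 0 < ε / (2 * (|C| + 1)) := by positivity
  have hf := lp.hasSum_single (by simp) f
  obtain ⟨s, hs⟩ := (Metric.tendsto_nhds.1 hf _ hδ).exists
  set p : WH2 := ∑ n ∈ s, lp.single 2 n (f n)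
  have hp : Tendsto (fun i => S i p) l (𝓝 p) := by
    simp only [p, map_sum]
    refine tendsto_finsetSum _ fun n _ => ?_
    have h1 : (lp.single 2 n (f n) : WH2) = f n • lp.single 2 n (1 : ℂ) := by
      rw [← lp.single_smul, smul_eq_mul, mul_one]
    simp only [h1, map_smul]
    exact (h n).const_smul _
  filter_upwards [hC, Metric.tendsto_nhds.1 hp _ (half_pos hε)] with i hi hip
  rw [dist_eq_norm] at hip hs ⊢
  have h1 : S i f - f = (S i p - p) + (p - f) - S i (p - f) := by
    rw [map_sub]
    abel
  have h2 : ‖S i (p - f)‖ ≤ |C| * ‖p - f‖ :=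
    (hi _).trans (mul_le_mul_of_nonneg_right (le_abs_self C) (norm_nonneg _))
  have h3 : (|C| + 1) * ‖p - f‖ < ε / 2 := by
    rw [lt_div_iff₀ (by positivity)] at hs
    linarith
  rw [h1]
  refine (norm_sub_le _ _).trans_lt ?_
  have h4 := norm_add_le (S i p - p) (p - f)
  linarith

/-- The operators `T t`, `t ≥ 0`, are uniformly bounded and act as composition with `φ t`. -/
structure IsBoundedCompFamily (β : ℕ → ℝ) (φ : ℝ → ℂ → ℂ) (T : ℝ → WH2 →L[ℂ] WH2) (C : ℝ) :
    Prop where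
  one_le : ∀ n, 1 ≤ β n
  isSemiflow : IsSemiflow φ
  representsComp : ∀ t, 0 ≤ t → RepresentsComp β (T t) (φ t)
  norm_le : ∀ t, 0 ≤ t → ∀ f, ‖T t f‖ ≤ C * ‖f‖

namespace IsBoundedCompFamily

variable {β : ℕ → ℝ} {W : ℝ → ℝ} {φ : ℝ → ℂ → ℂ} {T : ℝ → WH2 →L[ℂ] WH2} {C : ℝ}

theorem eval (h : IsBoundedCompFamily β φ T C) {t : ℝ} (ht : 0 ≤ t) (f : WH2) {z : ℂ}
    (hz : z ∈ uDisc) : wToFun β (T t f) z = wToFun β f (φ t z) :=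
  (h.representsComp t ht).2.2 f z hz

theorem zero_eq (h : IsBoundedCompFamily β φ T C) : T 0 = 1 := by
  ext1 f
  refine wToFun_injective h.one_le fun z hz => ?_
  rw [h.eval le_rfl f hz, h.isSemiflow.1 z hz, one_apply_eq_self]

theorem add_eq (h : IsBoundedCompFamily β φ T C) {s t : ℝ} (hs : 0 ≤ s) (ht : 0 ≤ t) :
    T (s + t) = (T s).comp (T t) := by
  ext1 f
  refine wToFun_injective h.one_le fun z hz => ?_
  rw [ContinuousLinearMap.comp_apply, h.eval (add_nonneg hs ht) f hz, h.eval hs _ hz,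
    h.eval ht _ (h.isSemiflow.mem hs hz), add_comm, h.isSemiflow.2.2.1 t s ht hs z hz]

theorem tendsto_zero (h : IsBoundedCompFamily β φ T C) (hβ : IsAreaWeight β W) {L : ℝ}
    (hL : ∀ t ∈ Icc (0 : ℝ) 1, ∀ z ∈ uDisc, ‖deriv (φ t) z‖ ≤ L) (f : WH2) :
    Tendsto (fun t => T t f) (𝓝[≥] 0) (𝓝 f) := by
  refine tendsto_apply_of_tendsto_single (l := 𝓝[≥] 0)
    (eventually_mem_nhdsWithin.mono fun t ht => h.norm_le t ht) (fun n => ?_) f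
  have hb : (β n : ℂ) ≠ 0 := by exact_mod_cast (hβ.pos n).ne'
  have he : (lp.single 2 n (1 : ℂ) : WH2) = (β n : ℂ)⁻¹ • eW β n := by
    rw [eW_eq_smul, smul_smul, inv_mul_cancel₀ hb, one_smul]
  simp only [he, map_smul]
  refine Tendsto.const_smul ?_ _
  have hE := hβ.tendsto_areaEnergy_pow_sub h.isSemiflow hL n
  have hEr := (ENNReal.tendsto_toReal ENNReal.zero_ne_top).comp hE
  have h0 : Tendsto (fun t => ‖φ t 0 ^ n - 0 ^ n‖ ^ 2) (𝓝[≥] 0) (𝓝 0) := by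
    simpa using (((h.isSemiflow.tendsto zero_mem_uDisc).pow n).sub_const (0 ^ n)).norm.pow 2
  have hsum := h0.add hEr
  rw [ENNReal.toReal_zero, add_zero] at hsum
  have hsq : Tendsto (fun t => ‖T t (eW β n) - eW β n‖ ^ 2) (𝓝[≥] 0) (𝓝 0) := by
    refine squeeze_zero' (Eventually.of_forall fun _ => sq_nonneg _) ?_ hsum
    filter_upwards [eventually_mem_nhdsWithin, hE.eventually_lt_const ENNReal.zero_lt_top] with
      t ht htE
    refine hβ.norm_sq_le (h := fun z => φ t z ^ n - z ^ n) (fun z hz => ?_)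
      ENNReal.toReal_nonneg (ENNReal.ofReal_toReal htE.ne).ge
    rw [← evalCLM_apply h.one_le hz, map_sub, evalCLM_apply, evalCLM_apply, h.eval ht _ hz,
      wToFun_eW h.one_le, wToFun_eW h.one_le]
  rw [tendsto_iff_norm_sub_tendsto_zero]
  simpa only [Real.sqrt_zero, Real.sqrt_sq (norm_nonneg _)] using hsq.sqrt

theorem continuousOn (h : IsBoundedCompFamily β φ T C)
    (h0 : ∀ f, Tendsto (fun t => T t f) (𝓝[≥] 0) (𝓝 f)) (f : WH2) :
    ContinuousOn (fun t => T t f) (Ici 0) := by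
  have key : ∀ s t, 0 ≤ s → s ≤ t → dist (T t f) (T s f) ≤ C * ‖T (t - s) f - f‖ := by
    intro s t hs hst
    have h1 : T t = (T s).comp (T (t - s)) := by
      rw [← h.add_eq hs (sub_nonneg.2 hst), add_sub_cancel]
    rw [h1, ContinuousLinearMap.comp_apply, dist_eq_norm, ← map_sub]
    exact h.norm_le s hs _
  have hlim : Tendsto (fun t => C * ‖T t f - f‖) (𝓝[≥] 0) (𝓝 0) := by
    simpa using ((h0 f).sub_const f).norm.const_mul C
  intro s hs
  have habs : Tendsto (fun t => |t - s|) (𝓝[Ici 0] s) (𝓝[≥] 0) := by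
    refine tendsto_nhdsWithin_iff.2 ⟨?_, Eventually.of_forall fun t => mem_Ici.2 (abs_nonneg _)⟩
    have h1 : Continuous fun t => |t - s| := by fun_prop
    simpa using (h1.tendsto s).mono_left nhdsWithin_le_nhds
  rw [ContinuousWithinAt, tendsto_iff_dist_tendsto_zero]
  refine squeeze_zero' (Eventually.of_forall fun _ => dist_nonneg) ?_ (hlim.comp habs)
  filter_upwards [self_mem_nhdsWithin] with t ht
  rcases le_total s t with hst | hst
  · rw [Function.comp_apply, abs_of_nonneg (sub_nonneg.2 hst)]
    exact key s t hs hst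
  · rw [Function.comp_apply, abs_sub_comm, abs_of_nonneg (sub_nonneg.2 hst), dist_comm]
    exact key t s ht hst

end IsBoundedCompFamily

theorem hasDerivAt_wToFun_comp {β : ℕ → ℝ} (hβ : ∀ n, 1 ≤ β n) {G : ℂ → ℂ} {φ : ℝ → ℂ → ℂ}
    (hφ : IsSemiflow φ) (hgen : SemiflowGenerator φ G) (f : WH2) {z : ℂ} (hz : z ∈ uDisc) {t : ℝ}
    (ht : 0 ≤ t) : HasDerivAt (fun s => wToFun β f (φ s z))
      (G (φ t z) * deriv (wToFun β f) (φ t z)) t :=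
  ((differentiableOn_wToFun hβ f).differentiableAt
    (isOpen_uDisc.mem_nhds (hφ.mem ht hz))).hasDerivAt.scomp_of_eq t (hgen z hz t ht) rfl

theorem opA_spec {β : ℕ → ℝ} {G : ℂ → ℂ} {f : WH2} (hf : f ∈ domA β G) {z : ℂ} (hz : z ∈ uDisc) :
    wToFun β (opA β G f) z = G z * deriv (wToFun β f) z := by
  rw [opA, dif_pos hf]
  exact hf.choose_spec z hz

namespace IsBoundedCompFamily

variable {β : ℕ → ℝ} {G : ℂ → ℂ} {φ : ℝ → ℂ → ℂ} {T : ℝ → WH2 →L[ℂ] WH2} {C : ℝ}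

theorem mem_domA (h : IsBoundedCompFamily β φ T C) (hgen : SemiflowGenerator φ G) {f y : WH2}
    (hy : GenLimit T f y) : f ∈ domA β G := by
  refine ⟨y, fun z hz => ?_⟩
  have h1 := ((evalCLM h.one_le hz).continuous.tendsto y).comp hy
  have h2 := (hasDerivAt_wToFun_comp h.one_le h.isSemiflow hgen f hz
    le_rfl).tendsto_slope_zero_right
  simp only [zero_add, h.isSemiflow.1 z hz] at h2
  refine tendsto_nhds_unique h1 (h2.congr' ?_)
  filter_upwards [self_mem_nhdsWithin] with t ht
  rw [Function.comp_apply, map_smul, map_sub, evalCLM_apply, evalCLM_apply,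
    h.eval (mem_Ioi.1 ht).le f hz, Complex.real_smul, smul_eq_mul, Complex.ofReal_inv]

theorem genLimit_opA (h : IsBoundedCompFamily β φ T C) (hgen : SemiflowGenerator φ G)
    (h0 : ∀ f, Tendsto (fun t => T t f) (𝓝[≥] 0) (𝓝 f)) {f : WH2} (hf : f ∈ domA β G) :
    GenLimit T f (opA β G f) := by
  set g := opA β G f
  have hS : Continuous fun s => T (max s 0) g :=
    (h.continuousOn h0 g).comp_continuous (by fun_prop) fun s => le_max_right s 0
  have hU : ∀ t, 0 ≤ t → ∫ s in (0 : ℝ)..t, T (max s 0) g = T t f - f := by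
    intro t ht
    refine wToFun_injective h.one_le fun z hz => ?_
    rw [← evalCLM_apply h.one_le hz, ← evalCLM_apply h.one_le hz, map_sub,
      ← ContinuousLinearMap.intervalIntegral_comp_comm _ (hS.intervalIntegrable 0 t),
      evalCLM_apply, evalCLM_apply, h.eval ht f hz]
    have h1 := intervalIntegral.integral_eq_sub_of_hasDerivAt (a := 0) (b := t)
      (f := fun s => wToFun β f (φ s z))
      (f' := fun s => evalCLM h.one_le hz (T (max s 0) g)) (fun s hs => by
        rw [uIcc_of_le ht] at hs
        refine (hasDerivAt_wToFun_comp h.one_le h.isSemiflow hgen f hz hs.1).congr_deriv ?_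
        rw [max_eq_left hs.1, evalCLM_apply, h.eval hs.1 _ hz,
          opA_spec hf (h.isSemiflow.mem hs.1 hz)])
      (((evalCLM h.one_le hz).continuous.comp hS).intervalIntegrable 0 t)
    rw [h1, h.isSemiflow.1 z hz]
  have hd := (hS.integral_hasStrictDerivAt 0 0).hasDerivAt.tendsto_slope_zero_right
  simp only [zero_add, intervalIntegral.integral_same, sub_zero, max_self, h.zero_eq,
    one_apply_eq_self] at hd
  refine hd.congr' ?_
  filter_upwards [self_mem_nhdsWithin] with t ht
  rw [hU t (mem_Ioi.1 ht).le, ← Complex.ofReal_inv, Complex.coe_smul]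
  rfl

end IsBoundedCompFamily

theorem IsAreaWeight.exists_semigroup {β : ℕ → ℝ} {W : ℝ → ℝ} (hβ : IsAreaWeight β W) {G : ℂ → ℂ}
    (hG : DifferentiableOn ℂ G uDisc) {φ : ℝ → ℂ → ℂ} (hφ : IsSemiflow φ)
    (hgen : SemiflowGenerator φ G) {η : ℝ} (hη : 0 < η) (hb : BoundaryReLe G 0 (-η)) {M : ℝ}
    (hM : ∀ z ∈ uDisc, |(deriv G z).re| ≤ M) :
    ∃ T : ℝ → WH2 →L[ℂ] WH2, IsC0Semigroup T ∧ IsGenerator T (domA β G) (opA β G) ∧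
      (∀ t : ℝ, 0 ≤ t → RepresentsComp β (T t) (φ t)) ∧ ∀ t : ℝ, 0 < t → IsTraceClass (T t) := by
  have hM0 : 0 ≤ M := (abs_nonneg _).trans (hM 0 zero_mem_uDisc)
  obtain ⟨ρ, hρ, c, hc, hin⟩ := exists_re_conj_mul_le hG hM hη hb
  set K := 2 / (1 - ρ ^ 2)
  have hK : 1 ≤ K := by
    rw [one_le_div (by nlinarith [hρ.1, hρ.2])]
    nlinarith [sq_nonneg ρ]
  have hT : ∀ t : ℝ, ∃ S : WH2 →L[ℂ] WH2, 0 ≤ t →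
      RepresentsComp β S (φ t) ∧ ∀ f, ‖S f‖ ≤ (2 * K + 1) * ‖f‖ := by
    intro t
    by_cases ht : 0 ≤ t
    · obtain ⟨S, hS⟩ := hβ.exists_representsComp (hφ.2.1 t ht).1 (hφ.2.1 t ht).2
        (hφ.injOn hgen hG hM ht) hK fun z hz => hφ.one_sub_norm_sq_le hgen hρ hc hin ht hz
      exact ⟨S, fun _ => hS⟩
    · exact ⟨0, fun h => absurd h ht⟩
  choose T hT using hT
  have hfam : IsBoundedCompFamily β φ T (2 * K + 1) :=
    ⟨hβ.one_le, hφ, fun t ht => (hT t ht).1, fun t ht => (hT t ht).2⟩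
  have h0 : ∀ f, Tendsto (fun t => T t f) (𝓝[≥] 0) (𝓝 f) :=
    hfam.tendsto_zero hβ (L := Real.exp M) fun t ht z hz =>
      (hφ.norm_deriv_le hgen hG hM ht.1 hz).trans
        (Real.exp_le_exp.2 (mul_le_of_le_one_right hM0 ht.2))
  refine ⟨T, ⟨hfam.zero_eq, fun s t hs ht => hfam.add_eq hs ht, h0⟩,
    ⟨fun f hf => hfam.genLimit_opA hgen h0 hf, fun f ⟨y, hy⟩ => hfam.mem_domA hgen hy⟩,
    hfam.representsComp, fun t ht => ?_⟩
  obtain ⟨r, hr0, hr1, hr⟩ := hφ.exists_norm_le hgen hρ hc hin ht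
  exact hβ.isTraceClass_of_representsComp (hfam.representsComp t ht.le) hr0 hr1 hr
    fun z hz => hφ.norm_deriv_le hgen hG hM ht.le hz

/-- If `ess sup_(z ∈ 𝕋) Re (z̄ G(z)) ≤ -η` for some `η > 0` and
`Re G'` is bounded on `𝔻`, then `A f = G f'` generates an immediately trace-class
semigroup of composition operators on `H²(𝔻)` and `𝒟`. -/
theorem statement11 (G : ℂ → ℂ) (hG : DifferentiableOn ℂ G uDisc)
    (φ : ℝ → ℂ → ℂ) (hφ : IsSemiflow φ) (hgen : SemiflowGenerator φ G)
    (η : ℝ) (hη : 0 < η) (hb : BoundaryReLe G 0 (-η))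
    (hG' : ∃ M : ℝ, ∀ z ∈ uDisc, |(deriv G z).re| ≤ M) :
    ∀ β : ℕ → ℝ, β = hardyW ∨ β = dirichletW →
      ∃ T : ℝ → WH2 →L[ℂ] WH2, IsC0Semigroup T ∧
        IsGenerator T (domA β G) (opA β G) ∧
        (∀ t : ℝ, 0 ≤ t → RepresentsComp β (T t) (φ t)) ∧
        (∀ t : ℝ, 0 < t → IsTraceClass (T t)) := by
  obtain ⟨M, hM⟩ := hG'
  rintro β (rfl | rfl)
  · exact isAreaWeight_hardyW.exists_semigroup hG hφ hgen hη hb hM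
  · exact isAreaWeight_dirichletW.exists_semigroup hG hφ hgen hη hb hM
end

section
/- Let φ : 𝔻 → 𝔻 be analytic such that the composition operator C_φ is compact on H²(𝔻). Then the Denjoy–Wolff point of φ lies in the open disc 𝔻 (not on the unit circle). -/
open Complex MeasureTheory Filter Set Metric
open scoped Real Topology ENNReal

section AdjointWeak

variable {E F : Type*} [NormedAddCommGroup E] [InnerProductSpace ℂ E] [CompleteSpace E]
  [NormedAddCommGroup F] [InnerProductSpace ℂ F] [CompleteSpace F]

/-- The adjoint of a compact operator maps bounded weakly null sequences to norm null sequences. -/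
theorem IsCompactOperator.tendsto_adjoint_of_weakly_null {T : E →L[ℂ] F}
    (hT : IsCompactOperator T) {u : ℕ → F} {C : ℝ} (hu : ∀ n, ‖u n‖ ≤ C)
    (hw : ∀ f, Tendsto (fun n => inner ℂ (u n) f) atTop (𝓝 0)) :
    Tendsto (fun n => ‖ContinuousLinearMap.adjoint T (u n)‖ ^ 2) atTop (𝓝 0) := by
  set S := ContinuousLinearMap.adjoint T with hS
  have hC : 0 ≤ C := (norm_nonneg _).trans (hu 0)
  have key : ∀ n, ‖S (u n)‖ ^ 2 = ‖inner ℂ (u n) (T (S (u n)))‖ := by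
    intro n
    rw [← ContinuousLinearMap.adjoint_inner_left, ← hS, inner_self_eq_norm_sq_to_K]
    simp
  obtain ⟨K, hK, hKT⟩ := hT.image_closedBall_subset_compact (f := (T : E →ₗ[ℂ] F)) (‖S‖ * C)
  have hmem : ∀ n, T (S (u n)) ∈ K := fun n => hKT
    ⟨S (u n), by simpa using S.le_opNorm_of_le (hu n), rfl⟩
  refine tendsto_of_subseq_tendsto fun ns hns => ?_
  obtain ⟨y, -, ms, hms, hy⟩ := hK.tendsto_subseq fun n => hmem (ns n)
  refine ⟨ms, ?_⟩
  have h₁ : Tendsto (fun n => C * ‖T (S (u (ns (ms n)))) - y‖ + ‖inner ℂ (u (ns (ms n))) y‖)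
      atTop (𝓝 0) := by
    have ha := (tendsto_iff_norm_sub_tendsto_zero.1 hy).const_mul C
    have hb := ((hw y).comp (hns.comp hms.tendsto_atTop)).norm
    simpa using ha.add hb
  refine squeeze_zero (fun n => by positivity) (fun n => ?_) h₁
  rw [key, ← sub_add_cancel (T (S (u (ns (ms n))))) y, inner_add_right, add_sub_cancel_right]
  refine (norm_add_le _ _).trans (add_le_add ((norm_inner_le_norm _ _).trans ?_) le_rfl)
  exact mul_le_mul_of_nonneg_right (hu _) (norm_nonneg _)

end AdjointWeak

/-- The Szegő reproducing kernel of `H²(𝔻)` at the point `w`, as a coefficient sequence. -/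
def szegoKernel (w : ℂ) (hw : w ∈ uDisc) : WH2 :=
  ⟨fun n => (starRingEnd ℂ) w ^ n, by
    refine memℓp_gen ?_
    have h : ‖w‖ ^ 2 < 1 := by
      have : ‖w‖ < 1 := by simpa [uDisc] using hw
      exact pow_lt_one₀ (norm_nonneg _) this two_ne_zero
    refine (summable_geometric_of_lt_one (by positivity) h).congr fun n => ?_
    simp [← pow_mul, mul_comm]⟩

theorem inner_szegoKernel (w : ℂ) (hw : w ∈ uDisc) (f : WH2) :
    inner ℂ (szegoKernel w hw) f = wToFun hardyW f w := by
  rw [lp.inner_eq_tsum]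
  simp [szegoKernel, wToFun, hardyW]

theorem one_sub_norm_sq_pos {w : ℂ} (hw : w ∈ uDisc) : 0 < 1 - ‖w‖ ^ 2 := by
  have : ‖w‖ < 1 := by simpa [uDisc] using hw
  nlinarith [norm_nonneg w]

theorem norm_szegoKernel_sq (w : ℂ) (hw : w ∈ uDisc) :
    ‖szegoKernel w hw‖ ^ 2 = (1 - ‖w‖ ^ 2)⁻¹ := by
  have h := lp.norm_rpow_eq_tsum (p := 2) (by norm_num) (szegoKernel w hw)
  have h1 : ‖w‖ ^ 2 < 1 := by linarith [one_sub_norm_sq_pos hw]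
  rw [← tsum_geometric_of_lt_one (by positivity) h1]
  simpa [szegoKernel, ← pow_mul, mul_comm] using h

theorem adjoint_szegoKernel {φ : ℂ → ℂ} {T : WH2 →L[ℂ] WH2} (hT : RepresentsComp hardyW T φ)
    (w : ℂ) (hw : w ∈ uDisc) :
    ContinuousLinearMap.adjoint T (szegoKernel w hw) = szegoKernel (φ w) (hT.2.1 hw) := by
  refine ext_inner_right ℂ fun f => ?_
  rw [ContinuousLinearMap.adjoint_inner_left, inner_szegoKernel, inner_szegoKernel, hT.2.2 f w hw]

/-- The Szegő kernel at `w`, normalized to have norm one. -/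
noncomputable def normalizedSzegoKernel (w : ℂ) (hw : w ∈ uDisc) : WH2 :=
  (√(1 - ‖w‖ ^ 2) : ℂ) • szegoKernel w hw

theorem norm_normalizedSzegoKernel (w : ℂ) (hw : w ∈ uDisc) :
    ‖normalizedSzegoKernel w hw‖ = 1 := by
  have h := one_sub_norm_sq_pos hw
  rw [← sq_eq_sq₀ (norm_nonneg _) zero_le_one, normalizedSzegoKernel, norm_smul, mul_pow,
    norm_szegoKernel_sq, Complex.norm_real, Real.norm_eq_abs, sq_abs, Real.sq_sqrt h.le,
    mul_inv_cancel₀ h.ne', one_pow]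

theorem norm_adjoint_normalizedSzegoKernel_sq {φ : ℂ → ℂ} {T : WH2 →L[ℂ] WH2}
    (hT : RepresentsComp hardyW T φ) (w : ℂ) (hw : w ∈ uDisc) :
    ‖ContinuousLinearMap.adjoint T (normalizedSzegoKernel w hw)‖ ^ 2 =
      (1 - ‖w‖ ^ 2) / (1 - ‖φ w‖ ^ 2) := by
  rw [normalizedSzegoKernel, map_smul, adjoint_szegoKernel hT, norm_smul, mul_pow,
    norm_szegoKernel_sq, Complex.norm_real, Real.norm_eq_abs, sq_abs,
    Real.sq_sqrt (one_sub_norm_sq_pos hw).le, div_eq_mul_inv]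

/-- Normalized Szegő kernels tend weakly to zero as the base point approaches the circle. -/
theorem tendsto_inner_normalizedSzegoKernel {z : ℕ → ℂ} (hz : ∀ n, z n ∈ uDisc)
    (hlim : Tendsto (fun n => ‖z n‖) atTop (𝓝 1)) (f : WH2) :
    Tendsto (fun n => inner ℂ (normalizedSzegoKernel (z n) (hz n)) f) atTop (𝓝 0) := by
  have hc : Tendsto (fun n => √(1 - ‖z n‖ ^ 2)) atTop (𝓝 0) := by
    simpa using ((hlim.pow 2).const_sub 1).sqrt
  have hsingle : ∀ (i : ℕ) (a : ℂ), Tendsto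
      (fun n => inner ℂ (normalizedSzegoKernel (z n) (hz n)) (lp.single 2 i a : WH2))
      atTop (𝓝 0) := by
    intro i a
    refine squeeze_zero_norm (fun n => ?_) (by simpa using hc.mul_const ‖a‖)
    have h : ‖z n‖ ^ i ≤ 1 := pow_le_one₀ (norm_nonneg _) (by
      simpa [uDisc] using (mem_ball_zero_iff.1 (hz n)).le)
    rw [normalizedSzegoKernel, inner_smul_left, lp.inner_single_right, norm_mul]
    simp only [szegoKernel, RCLike.inner_apply, norm_mul, RCLike.norm_conj, norm_pow,
      Complex.norm_real, Real.norm_eq_abs, abs_of_nonneg (Real.sqrt_nonneg _)]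
    gcongr
    nlinarith [norm_nonneg a]
  rw [Metric.tendsto_atTop]
  intro ε hε
  have hsum := lp.hasSum_single (p := 2) (by norm_num) f
  obtain ⟨s, hs⟩ := (Metric.tendsto_nhds.1 hsum (ε / 2) (by positivity)).exists
  have hfin := tendsto_finsetSum s fun i _ => hsingle i (f i)
  rw [Finset.sum_const_zero, Metric.tendsto_atTop] at hfin
  obtain ⟨N, hN⟩ := hfin (ε / 2) (by positivity)
  refine ⟨N, fun n hn => ?_⟩
  have h₁ := hN n hn
  rw [dist_zero_right, ← inner_sum] at h₁
  rw [dist_zero_right, ← sub_add_cancel f (∑ i ∈ s, lp.single 2 i (f i)), inner_add_right]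
  have h₂ := norm_inner_le_norm (𝕜 := ℂ) (normalizedSzegoKernel (z n) (hz n))
    (f - ∑ i ∈ s, lp.single 2 i (f i))
  rw [norm_normalizedSzegoKernel, one_mul, ← dist_eq_norm, dist_comm] at h₂
  refine (norm_add_le _ _).trans_lt ?_
  linarith

/-- If `C_φ` is compact on `H²(𝔻)`, then the Denjoy–Wolff point
of `φ` (the point to which the iterates of `φ` converge) lies in the open disc. -/
theorem statement12 (φ : ℂ → ℂ) (hφa : DifferentiableOn ℂ φ uDisc)
    (hφm : MapsTo φ uDisc uDisc)
    (T : WH2 →L[ℂ] WH2) (hT : RepresentsComp hardyW T φ)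
    (hc : IsCompactOperator T)
    (α : ℂ) (hα : α ∈ closure uDisc)
    (hdw : ∀ z ∈ uDisc, Tendsto (fun n : ℕ => φ^[n] z) atTop (𝓝 α)) :
    α ∈ uDisc := by
  by_contra hα'
  have hnorm : ‖α‖ = 1 := by
    refine le_antisymm ?_ (by simpa [uDisc] using hα')
    have := closure_ball_subset_closedBall hα
    simpa using this
  have h0 : (0 : ℂ) ∈ uDisc := by simp [uDisc]
  have hz : ∀ n, φ^[n] 0 ∈ uDisc := fun n => hφm.iterate n h0
  have hlim : Tendsto (fun n => ‖φ^[n] 0‖) atTop (𝓝 1) := hnorm ▸ (hdw 0 h0).norm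
  have hratio := hc.tendsto_adjoint_of_weakly_null
    (fun n => (norm_normalizedSzegoKernel _ (hz n)).le)
    (tendsto_inner_normalizedSzegoKernel hz hlim)
  obtain ⟨N, hN⟩ := eventually_atTop.1 (hratio.eventually_lt_const zero_lt_one)
  have hstep : ∀ n ≥ N, 1 - ‖φ^[n] 0‖ ^ 2 ≤ 1 - ‖φ^[n + 1] 0‖ ^ 2 := by
    intro n hn
    have h := hN n hn
    rw [norm_adjoint_normalizedSzegoKernel_sq hT, ← Function.iterate_succ_apply' φ n 0,
      div_lt_one (one_sub_norm_sq_pos (hz (n + 1)))] at h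
    exact h.le
  have hge : ∀ n ≥ N, 1 - ‖φ^[N] 0‖ ^ 2 ≤ 1 - ‖φ^[n] 0‖ ^ 2 := fun n hn =>
    Nat.le_induction le_rfl (fun m hm ih => ih.trans (hstep m hm)) n hn
  have hzero : Tendsto (fun n => 1 - ‖φ^[n] 0‖ ^ 2) atTop (𝓝 0) := by
    simpa using (hlim.pow 2).const_sub 1
  exact (one_sub_norm_sq_pos (hz N)).not_ge
    (ge_of_tendsto hzero (eventually_atTop.2 ⟨N, hge⟩))
end

section
/- Let (φ_t)_{t≥0} be a semiflow on 𝔻 with Denjoy–Wolff point 0, with semiflow model φ_t(z) = h^{-1}(e^{-ct} h(z)) where Re c ≥ 0 and h : 𝔻 → Ω is a conformal bijection onto a spiral-like domain Ω with h(0) = 0. The following are equivalent: (1) there exists t₀ > 0 with ‖φ_{t₀}‖_∞ < 1; (2) there exists t₀ > 0 with ‖φ_t‖_∞ < 1 for all t ≥ t₀; (3) Re c > 0 and the domain Ω is bounded. -/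
open Complex MeasureTheory Filter Set Metric
open scoped Real Topology ENNReal

/-- If `h` is injective and holomorphic on the disc with `h 0 = 0`, then a self-map `f` of the
disc satisfies `‖f‖_∞ < 1` as soon as `h ∘ f` is uniformly small. -/
lemma exists_supNormLtOne_of_small {h : ℂ → ℂ} (hh : DifferentiableOn ℂ h uDisc)
    (hinj : InjOn h uDisc) (h0 : h 0 = 0) :
    ∃ δ > 0, ∀ f : ℂ → ℂ, MapsTo f uDisc uDisc → (∀ z ∈ uDisc, ‖h (f z)‖ < δ) →
      SupNormLtOne f := by
  have hopen : IsOpen (h '' ball 0 (1 / 2)) := by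
    have hsub : ball (0 : ℂ) (1 / 2) ⊆ uDisc := ball_subset_ball (by norm_num)
    rcases (hh.analyticOnNhd isOpen_ball).is_constant_or_isOpen
      (convex_ball (0 : ℂ) 1).isPreconnected with ⟨w, hw⟩ | H
    · have m0 : (0 : ℂ) ∈ uDisc := by simp [uDisc]
      have m1 : (1 / 2 : ℂ) ∈ uDisc := by norm_num [uDisc]
      have := hinj m0 m1 ((hw 0 m0).trans (hw _ m1).symm)
      norm_num at this
    · exact H _ hsub isOpen_ball
  obtain ⟨δ, hδ, hball⟩ := Metric.isOpen_iff.1 hopen 0 ⟨0, by simp, h0⟩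
  refine ⟨δ, hδ, fun f hf hsmall => ⟨1 / 2, by norm_num, fun z hz => ?_⟩⟩
  obtain ⟨w, hw, hwe⟩ := hball (mem_ball_zero_iff.2 (hsmall z hz))
  have hwD : w ∈ uDisc := ball_subset_ball (by norm_num) hw
  rw [← hinj hwD (hf hz) hwe]
  exact (mem_ball_zero_iff.1 hw).le

/-- If `‖f‖_∞ < 1`, the values of `‖h‖` on the range of `f` are dominated by a value of `‖h‖`
attained in the disc. -/
lemma SupNormLtOne.exists_norm_le {h f : ℂ → ℂ} (hh : DifferentiableOn ℂ h uDisc)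
    (hf : SupNormLtOne f) : ∃ x ∈ uDisc, ∀ z ∈ uDisc, ‖h (f z)‖ ≤ ‖h x‖ := by
  obtain ⟨r, hr, hfr⟩ := hf
  have hsub : closedBall (0 : ℂ) r ⊆ uDisc := closedBall_subset_ball hr
  have hr0 : 0 ≤ r := (norm_nonneg _).trans (hfr 0 (by simp [uDisc]))
  obtain ⟨x, hx, hmax⟩ := (isCompact_closedBall (0 : ℂ) r).exists_isMaxOn
    ⟨0, by simpa using hr0⟩ (hh.continuousOn.mono hsub).norm
  exact ⟨x, hsub hx, fun z hz => hmax (mem_closedBall_zero_iff.2 (hfr z hz))⟩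

lemma norm_exp_neg_mul_ofReal (c : ℂ) (t : ℝ) :
    ‖Complex.exp (-(c * (t : ℂ)))‖ = Real.exp (-(c.re * t)) := by
  simp [Complex.norm_exp]

/-- For a semiflow with Denjoy–Wolff point `0` and model
`φ_t = h⁻¹(e^{-ct} h)`, the conditions (1) `‖φ_{t₀}‖_∞ < 1` for some `t₀ > 0`,
(2) `‖φ_t‖_∞ < 1` for all large `t`, and (3) `Re c > 0` and `Ω` bounded, are
equivalent. -/
theorem statement13 (φ : ℝ → ℂ → ℂ) (hφ : IsSemiflow φ)
    (c : ℂ) (hc : 0 ≤ c.re) (Ω : Set ℂ) (hΩ : IsOpen Ω) (h : ℂ → ℂ)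
    (hh : DifferentiableOn ℂ h uDisc) (hinj : InjOn h uDisc)
    (him : h '' uDisc = Ω) (h0 : h 0 = 0)
    (hspiral : ∀ w ∈ Ω, ∀ t : ℝ, 0 ≤ t → Complex.exp (-(c * (t : ℂ))) * w ∈ Ω)
    (hmodel : ∀ t : ℝ, 0 ≤ t → ∀ z ∈ uDisc,
      h (φ t z) = Complex.exp (-(c * (t : ℂ))) * h z) :
    List.TFAE
      [ ∃ t₀ : ℝ, 0 < t₀ ∧ SupNormLtOne (φ t₀),
        ∃ t₀ : ℝ, 0 < t₀ ∧ ∀ t : ℝ, t₀ ≤ t → SupNormLtOne (φ t),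
        0 < c.re ∧ Bornology.IsBounded Ω ] := by
  tfae_have 2 → 1 := fun ⟨t₀, ht₀, H⟩ => ⟨t₀, ht₀, H t₀ le_rfl⟩
  tfae_have 1 → 3 := by
    rintro ⟨t₀, ht₀, H⟩
    obtain ⟨x, hx, hmax⟩ := H.exists_norm_le hh
    have key : ∀ z ∈ uDisc, Real.exp (-(c.re * t₀)) * ‖h z‖ ≤ ‖h x‖ := fun z hz => by
      have := hmax z hz
      rwa [hmodel t₀ ht₀.le z hz, norm_mul, norm_exp_neg_mul_ofReal] at this
    constructor
    · refine lt_of_le_of_ne hc fun hc0 => ?_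
      have hM : IsMaxOn (norm ∘ h) uDisc x := fun z hz => by
        simpa [← hc0] using key z hz
      have hconst := Complex.eqOn_of_isPreconnected_of_isMaxOn_norm
        (convex_ball (0 : ℂ) 1).isPreconnected isOpen_ball hh hx hM
      have m0 : (0 : ℂ) ∈ uDisc := by simp [uDisc]
      have m1 : (1 / 2 : ℂ) ∈ uDisc := by norm_num [uDisc]
      have := hinj m0 m1 ((hconst m0).trans (hconst m1).symm)
      norm_num at this
    · refine isBounded_iff_forall_norm_le.2 ⟨‖h x‖ / Real.exp (-(c.re * t₀)), ?_⟩
      rw [← him]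
      rintro _ ⟨z, hz, rfl⟩
      rw [le_div_iff₀ (Real.exp_pos _), mul_comm]
      exact key z hz
  tfae_have 3 → 2 := by
    rintro ⟨hcpos, hbdd⟩
    obtain ⟨δ, hδ, hsmall⟩ := exists_supNormLtOne_of_small hh hinj h0
    obtain ⟨R, hR⟩ := isBounded_iff_forall_norm_le.1 hbdd
    have hlim : Tendsto (fun t : ℝ => Real.exp (-(c.re * t)) * R) atTop (𝓝 0) := by
      simpa using (Real.tendsto_exp_neg_atTop_nhds_zero.comp
        (tendsto_id.const_mul_atTop hcpos)).mul_const R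
    obtain ⟨T, hT⟩ := eventually_atTop.1 (hlim.eventually_lt_const hδ)
    refine ⟨max T 1, by positivity, fun t ht => ?_⟩
    have ht0 : 0 ≤ t := zero_le_one.trans ((le_max_right _ _).trans ht)
    refine hsmall _ (hφ.2.1 t ht0).2 fun z hz => ?_
    rw [hmodel t ht0 z hz, norm_mul, norm_exp_neg_mul_ofReal]
    exact (mul_le_mul_of_nonneg_left (hR _ (him ▸ mem_image_of_mem h hz))
      (Real.exp_pos _).le).trans_lt (hT t ((le_max_left _ _).trans ht))
  tfae_finish
end
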